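/- arXiv:2209.14177 — 2 statements merged into one kernel-verified Lean document; each statement's English description precedes it below -/
import Mathlib

section
/- Fix an integer k ≥ 3. Suppose that for every ε > 0 there exists m₀ such that for every m ≥ m₀, every (k+2, k)-free 3-graph F' on m vertices contains a subgraph F with at least |F'| − ε·m² edges which is (ℓ+1, ℓ)-free for every ℓ with 2 ≤ ℓ ≤ k−1. Then the limit of n^{-2} f^{(3)}(n; k+2, k) as n tends to infinity exists, i.e., the liminf and the limsup of n^{-2} f^{(3)}(n; k+2, k) coincide. -/
open Finset Filter

/-- An `r`-graph is `(s,k)`-free if it has no `k` distinct edges spanning at most `s` vertices. -/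
def IsFree {V : Type*} [DecidableEq V] (G : Finset (Finset V)) (s k : ℕ) : Prop :=
  ¬ ∃ S ⊆ G, S.card = k ∧ (S.sup id).card ≤ s

/-- `exNum r n s k` is the maximum number of edges of an `(s,k)`-free `r`-uniform
hypergraph on `n` vertices, i.e. `f^{(r)}(n; s, k)`. -/
noncomputable def exNum (r n s k : ℕ) : ℕ :=
  sSup {m : ℕ | ∃ G : Finset (Finset (Fin n)),
    (∀ e ∈ G, e.card = r) ∧ IsFree G s k ∧ G.card = m}

section GreedyConflictFree

open MeasureTheory ProbabilityTheory

section CoordinateAlgebra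

variable {Ω I : Type*} [mΩ : MeasurableSpace Ω]

/-- The σ-algebra generated by the coordinates `U i` with `i ∈ J`. -/
def coordAlgebra (U : I → Ω → ℝ) (J : Set I) : MeasurableSpace Ω :=
  ⨆ i ∈ J, MeasurableSpace.comap (U i) inferInstance

lemma coordAlgebra_mono (U : I → Ω → ℝ) {J J' : Set I} (h : J ⊆ J') :
    coordAlgebra U J ≤ coordAlgebra U J' :=
  biSup_mono h

lemma MeasurableSet.coordAlgebra_mono {U : I → Ω → ℝ} {J J' : Set I} {A : Set Ω}
    (hA : MeasurableSet[coordAlgebra U J] A) (h : J ⊆ J') :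
    MeasurableSet[coordAlgebra U J'] A :=
  _root_.coordAlgebra_mono U h A hA

lemma coordAlgebra_le {U : I → Ω → ℝ} (hU : ∀ i, Measurable (U i)) (J : Set I) :
    coordAlgebra U J ≤ mΩ :=
  iSup₂_le fun i _ => (hU i).comap_le

lemma measurableSet_coordAlgebra_preimage (U : I → Ω → ℝ) {J : Set I} {i : I} (hi : i ∈ J)
    {s : Set ℝ} (hs : MeasurableSet s) : MeasurableSet[coordAlgebra U J] (U i ⁻¹' s) :=
  le_iSup₂ (f := fun i (_ : i ∈ J) => MeasurableSpace.comap (U i) inferInstance) i hi _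
    ⟨s, hs, rfl⟩

variable {μ : Measure Ω}

lemma measureReal_inter_of_disjoint_coords {U : I → Ω → ℝ} (hU : ∀ i, Measurable (U i))
    (hind : iIndepFun U μ) {J J' : Set I} (hJ : Disjoint J J') {A A' : Set Ω}
    (hA : MeasurableSet[coordAlgebra U J] A) (hA' : MeasurableSet[coordAlgebra U J'] A') :
    μ.real (A ∩ A') = μ.real A * μ.real A' := by
  have h := indep_iSup_of_disjoint (fun i => (hU i).comap_le) hind hJ
  rw [Indep_iff] at h
  simp only [Measure.real, h A A' hA hA', ENNReal.toReal_mul]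

lemma measureReal_biInter_of_disjoint_coords [IsProbabilityMeasure μ] {U : I → Ω → ℝ}
    (hU : ∀ i, Measurable (U i)) (hind : iIndepFun U μ) {κ : Type*} (s : Finset κ)
    (A : κ → Set Ω) (J : κ → Set I)
    (hA : ∀ i ∈ s, MeasurableSet[coordAlgebra U (J i)] (A i))
    (hJ : (s : Set κ).PairwiseDisjoint J) :
    MeasurableSet[coordAlgebra U (⋃ i ∈ s, J i)] (⋂ i ∈ s, A i) ∧
      μ.real (⋂ i ∈ s, A i) = ∏ i ∈ s, μ.real (A i) := by
  classical
  induction s using Finset.induction with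
  | empty => simp
  | insert x s hx ih =>
    obtain ⟨h1, h2⟩ := ih (fun i hi => hA i (mem_insert_of_mem hi))
      (hJ.subset (by simp [Set.subset_insert]))
    have hxs : MeasurableSet[coordAlgebra U (J x)] (A x) := hA x (mem_insert_self _ _)
    have hdisj : Disjoint (J x) (⋃ i ∈ s, J i) := by
      simp only [Set.disjoint_iUnion_right]
      intro i hi
      exact hJ (by simp) (by simp [hi]) (by rintro rfl; exact hx hi)
    rw [Finset.set_biInter_insert]
    refine ⟨?_, ?_⟩
    · refine MeasurableSet.inter ?_ ?_
      · exact MeasurableSet.coordAlgebra_mono hxs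
          (Set.subset_biUnion_of_mem (u := J) (mem_insert_self x s))
      · exact MeasurableSet.coordAlgebra_mono h1
          (Set.biUnion_subset_biUnion_left fun i hi => mem_insert_of_mem hi)
    · rw [measureReal_inter_of_disjoint_coords hU hind hdisj hxs h1, h2, prod_insert hx]

end CoordinateAlgebra

section GreedyChoice

variable {Ω ι : Type*} [DecidableEq ι]

/-- The event that `c` may be added at time `t` to the set `S ω`: it is not yet there, and no member
of `𝒞` inside `f` that contains `c` has all its other elements in `S ω` or active at time `t`. -/
def admissible (𝒞 : Finset (Finset ι)) (U : ℕ × ι → Ω → ℝ) (a : ℝ) (f : Finset ι)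
    (S : Ω → Set ι) (t : ℕ) (c : ι) : Set Ω :=
  {ω | c ∉ S ω ∧ ∀ X ∈ 𝒞, c ∈ X → X ⊆ f → ∃ c' ∈ X, c' ≠ c ∧ c' ∉ S ω ∧ a ≤ U (t, c') ω}

/-- Random greedy choice of a subset of `f` containing no member of `𝒞`. At time `t` the element `c`
is active when `U (t, c) < a`, and it is added when moreover `U (t, c) < τ t c` and it is
admissible. -/
def greedy (𝒞 : Finset (Finset ι)) (U : ℕ × ι → Ω → ℝ) (a : ℝ) (τ : ℕ → ι → ℝ) (f : Finset ι) :
    ℕ → Ω → Set ι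
  | 0, _ => ∅
  | t + 1, ω => {c | c ∈ greedy 𝒞 U a τ f t ω ∨ (c ∈ f ∧ U (t, c) ω < a ∧ U (t, c) ω < τ t c ∧
      ω ∈ admissible 𝒞 U a f (greedy 𝒞 U a τ f t) t c)}

/-- The elements within distance `t` of `c` in the hypergraph of members of `𝒞` inside `f`. -/
def conflictBall (𝒞 : Finset (Finset ι)) (f : Finset ι) : ℕ → ι → Set ι
  | 0, c => {c}
  | t + 1, c => {z | z ∈ conflictBall 𝒞 f t c ∨
      ∃ X ∈ 𝒞, c ∈ X ∧ X ⊆ f ∧ ∃ c' ∈ X, z ∈ conflictBall 𝒞 f t c'}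

variable {𝒞 : Finset (Finset ι)} {U : ℕ × ι → Ω → ℝ} {a : ℝ} {τ : ℕ → ι → ℝ} {f : Finset ι}

lemma self_mem_conflictBall (t : ℕ) (c : ι) : c ∈ conflictBall 𝒞 f t c := by
  induction t with
  | zero => rfl
  | succ t ih => exact Or.inl ih

lemma conflictBall_subset {c : ι} (hc : c ∈ f) (t : ℕ) : conflictBall 𝒞 f t c ⊆ f := by
  induction t generalizing c with
  | zero => simpa [conflictBall] using hc
  | succ t ih =>
    rintro z (hz | ⟨X, -, -, hXf, c', hc', hz⟩)
    · exact ih hc hz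
    · exact ih (hXf hc') hz

lemma greedy_not_subset (h𝒞 : ∅ ∉ 𝒞) (t : ℕ) (ω : Ω) {X : Finset ι} (hX : X ∈ 𝒞) (hXf : X ⊆ f) :
    ¬ (X : Set ι) ⊆ greedy 𝒞 U a τ f t ω := by
  induction t with
  | zero =>
    intro h
    have : X = ∅ := by simpa [greedy] using h
    exact h𝒞 (this ▸ hX)
  | succ t ih =>
    intro h
    obtain ⟨c, hcX, hct⟩ := Set.not_subset.1 ih
    rcases h hcX with h1 | ⟨-, -, -, h4⟩
    · exact hct h1
    obtain ⟨c', hc'X, -, hc't, hac'⟩ := h4.2 X hX hcX hXf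
    rcases h hc'X with h1 | ⟨-, h2, -, -⟩
    · exact hc't h1
    · exact absurd h2 (not_lt.2 hac')

lemma measurableSet_admissible_of_coords [Finite ι] [MeasurableSpace Ω] {S : Ω → Set ι} {t : ℕ} {c : ι}
    {J : Set (ℕ × ι)} (hc : MeasurableSet[coordAlgebra U J] {ω | c ∈ S ω})
    (hS : ∀ X ∈ 𝒞, c ∈ X → X ⊆ f → ∀ c' ∈ X, c' ≠ c →
      MeasurableSet[coordAlgebra U J] {ω | c' ∈ S ω} ∧ (t, c') ∈ J) :
    MeasurableSet[coordAlgebra U J] (admissible 𝒞 U a f S t c) := by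
  have hrw : admissible 𝒞 U a f S t c = {ω | c ∈ S ω}ᶜ ∩ ⋂ (X : Finset ι) (_ : X ∈ 𝒞)
      (_ : c ∈ X) (_ : X ⊆ f), ⋃ (c' : ι) (_ : c' ∈ X) (_ : c' ≠ c),
        ({ω | c' ∈ S ω}ᶜ ∩ U (t, c') ⁻¹' Set.Ici a) := by
    ext ω
    simp only [admissible, Set.mem_ofPred_eq, Set.mem_inter_iff, Set.mem_compl_iff, Set.mem_iInter,
      Set.mem_iUnion, Set.mem_preimage, Set.mem_Ici, exists_prop]
  rw [hrw]
  refine hc.compl.inter ?_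
  refine MeasurableSet.iInter fun X => MeasurableSet.iInter fun hX => MeasurableSet.iInter fun hcX =>
    MeasurableSet.iInter fun hXf => MeasurableSet.iUnion fun c' => MeasurableSet.iUnion fun hc' =>
    MeasurableSet.iUnion fun hne => ?_
  exact (hS X hX hcX hXf c' hc' hne).1.compl.inter
    (measurableSet_coordAlgebra_preimage U (hS X hX hcX hXf c' hc' hne).2 measurableSet_Ici)

lemma measurableSet_mem_greedy [Finite ι] [MeasurableSpace Ω] (t : ℕ) (c : ι) :
    MeasurableSet[coordAlgebra U {i | i.1 < t ∧ i.2 ∈ conflictBall 𝒞 f t c}]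
      {ω | c ∈ greedy 𝒞 U a τ f t ω} := by
  induction t generalizing c with
  | zero => simp [greedy]
  | succ t ih =>
    have hrw : {ω | c ∈ greedy 𝒞 U a τ f (t + 1) ω} = {ω | c ∈ greedy 𝒞 U a τ f t ω} ∪
        ({_ω | c ∈ f} ∩ (U (t, c) ⁻¹' Set.Iio a ∩ (U (t, c) ⁻¹' Set.Iio (τ t c) ∩
          admissible 𝒞 U a f (greedy 𝒞 U a τ f t) t c))) := by
      ext ω
      simp [greedy]
    have hmem : (t, c) ∈ {i : ℕ × ι | i.1 < t + 1 ∧ i.2 ∈ conflictBall 𝒞 f (t + 1) c} :=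
      ⟨Nat.lt_succ_self t, self_mem_conflictBall _ _⟩
    have hself : MeasurableSet[coordAlgebra U {i | i.1 < t + 1 ∧ i.2 ∈ conflictBall 𝒞 f (t + 1) c}]
        {ω | c ∈ greedy 𝒞 U a τ f t ω} :=
      (ih c).coordAlgebra_mono fun i hi => ⟨hi.1.trans (Nat.lt_succ_self t), Or.inl hi.2⟩
    rw [hrw]
    refine hself.union ((MeasurableSet.const _).inter
      ((measurableSet_coordAlgebra_preimage U hmem measurableSet_Iio).inter
      ((measurableSet_coordAlgebra_preimage U hmem measurableSet_Iio).inter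
      (measurableSet_admissible_of_coords hself ?_))))
    intro X hX hcX hXf c' hc' _
    refine ⟨(ih c').coordAlgebra_mono fun i hi => ⟨hi.1.trans (Nat.lt_succ_self t), ?_⟩,
      Nat.lt_succ_self t, ?_⟩
    · exact Or.inr ⟨X, hX, hcX, hXf, c', hc', hi.2⟩
    · exact Or.inr ⟨X, hX, hcX, hXf, c', hc', self_mem_conflictBall _ _⟩

lemma measurableSet_admissible [Finite ι] [MeasurableSpace Ω] (t : ℕ) (c : ι) :
    MeasurableSet[coordAlgebra U {(t, c)}ᶜ]
      (admissible 𝒞 U a f (greedy 𝒞 U a τ f t) t c) := by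
  have h (c' : ι) : MeasurableSet[coordAlgebra U {(t, c)}ᶜ]
      {ω | c' ∈ greedy 𝒞 U a τ f t ω} := by
    refine (measurableSet_mem_greedy t c').coordAlgebra_mono ?_
    rintro ⟨s, z⟩ ⟨hs, -⟩
    simp only [Set.mem_compl_iff, Set.mem_singleton_iff, Prod.mk.injEq, not_and]
    rintro rfl
    exact absurd hs (lt_irrefl _)
  refine measurableSet_admissible_of_coords (h c) fun X _ _ _ c' _ hne => ⟨h c', ?_⟩
  simp [hne]

/-- While `b` is inactive the process runs as if `b` were absent. -/
lemma greedy_eq_erase [Fintype ι] {b : ι} {t : ℕ} {ω : Ω} (hb : ∀ s < t, a ≤ U (s, b) ω) :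
    greedy 𝒞 U a τ univ t ω = greedy 𝒞 U a τ (univ.erase b) t ω ∧
      b ∉ greedy 𝒞 U a τ univ t ω := by
  induction t with
  | zero => simp [greedy]
  | succ t ih =>
    obtain ⟨h1, h2⟩ := ih fun s hs => hb s (hs.trans (Nat.lt_succ_self t))
    have hbt := hb t (Nat.lt_succ_self t)
    constructor
    · ext c
      by_cases hcb : c = b
      · subst hcb
        have h3 : c ∉ greedy 𝒞 U a τ (univ.erase c) t ω := h1 ▸ h2
        simp [greedy, h2, h3, not_lt.2 hbt]
      · simp only [greedy, Set.mem_ofPred_eq, h1, mem_univ, true_and, mem_erase, ne_eq, hcb,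
          not_false_eq_true, and_true, admissible]
        refine or_congr Iff.rfl (and_congr Iff.rfl (and_congr Iff.rfl (and_congr Iff.rfl ?_)))
        refine forall₃_congr fun X hX hcX => ?_
        constructor
        · intro h _
          exact h (subset_univ _)
        · intro h _
          by_cases hbX : b ∈ X
          · exact ⟨b, hbX, fun h => hcb h.symm, h1 ▸ h2, hbt⟩
          · exact h fun z hz => mem_erase.2 ⟨fun hzb => hbX (hzb ▸ hz), mem_univ _⟩
    · rintro (h | ⟨-, h, -⟩)
      · exact h2 h
      · exact absurd h (not_lt.2 hbt)

/-- The process with thresholds chosen so that each element is added at each time with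
probability `q`. -/
def balancedGreedy [Fintype ι] [MeasurableSpace Ω] (μ : Measure Ω) (𝒞 : Finset (Finset ι))
    (U : ℕ × ι → Ω → ℝ) (a q : ℝ) : ℕ → Ω → Set ι
  | 0, _ => ∅
  | t + 1, ω => {c | c ∈ balancedGreedy μ 𝒞 U a q t ω ∨ (c ∈ (univ : Finset ι) ∧ U (t, c) ω < a ∧
      U (t, c) ω < q / μ.real (admissible 𝒞 U a univ (balancedGreedy μ 𝒞 U a q t) t c) ∧
      ω ∈ admissible 𝒞 U a univ (balancedGreedy μ 𝒞 U a q t) t c)}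

lemma exists_balanced_thresholds [Fintype ι] [MeasurableSpace Ω] (μ : Measure Ω)
    (𝒞 : Finset (Finset ι)) (U : ℕ × ι → Ω → ℝ) (a q : ℝ) :
    ∃ τ : ℕ → ι → ℝ, ∀ t c,
      τ t c = q / μ.real (admissible 𝒞 U a univ (greedy 𝒞 U a τ univ t) t c) := by
  refine ⟨fun t c => q / μ.real (admissible 𝒞 U a univ (balancedGreedy μ 𝒞 U a q t) t c), ?_⟩
  intro t c
  suffices h : ∀ t, greedy 𝒞 U a (fun t c => q / μ.real (admissible 𝒞 U a univ
      (balancedGreedy μ 𝒞 U a q t) t c)) univ t = balancedGreedy μ 𝒞 U a q t by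
    rw [h]
  intro t
  induction t with
  | zero => rfl
  | succ t ih =>
    funext ω
    simp only [greedy, balancedGreedy, ih]

end GreedyChoice

section Balance

variable {Ω ι : Type*} [DecidableEq ι] [Fintype ι] [mΩ : MeasurableSpace Ω] {μ : Measure Ω}
  [IsProbabilityMeasure μ] {𝒞 : Finset (Finset ι)} {U : ℕ × ι → Ω → ℝ} {a q : ℝ} {τ : ℕ → ι → ℝ}

lemma measureReal_mem_greedy_succ (hU : ∀ i, Measurable (U i)) (hind : iIndepFun U μ)
    (hunif : ∀ i x, 0 ≤ x → x ≤ 1 → μ.real (U i ⁻¹' Set.Iio x) = x) {t : ℕ} {c : ι}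
    (hadm : 0 < μ.real (admissible 𝒞 U a univ (greedy 𝒞 U a τ univ t) t c))
    (hτ : τ t c = q / μ.real (admissible 𝒞 U a univ (greedy 𝒞 U a τ univ t) t c))
    (hτ0 : 0 ≤ τ t c) (hτa : τ t c ≤ a) (ha : a ≤ 1) :
    μ.real {ω | c ∈ greedy 𝒞 U a τ univ (t + 1) ω} =
      μ.real {ω | c ∈ greedy 𝒞 U a τ univ t ω} + q := by
  set A := admissible 𝒞 U a univ (greedy 𝒞 U a τ univ t) t c with hA
  have hAm : MeasurableSet[coordAlgebra U {(t, c)}ᶜ] A := measurableSet_admissible t c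
  have hBm : MeasurableSet[coordAlgebra U {(t, c)}] (U (t, c) ⁻¹' Set.Iio (τ t c)) :=
    measurableSet_coordAlgebra_preimage U (Set.mem_singleton _) measurableSet_Iio
  have hrw : {ω | c ∈ greedy 𝒞 U a τ univ (t + 1) ω} = {ω | c ∈ greedy 𝒞 U a τ univ t ω} ∪
      (U (t, c) ⁻¹' Set.Iio (τ t c) ∩ A) := by
    ext ω
    simp only [greedy, Set.mem_ofPred_eq, mem_univ, true_and, Set.mem_union, Set.mem_inter_iff,
      Set.mem_preimage, Set.mem_Iio]
    refine or_congr Iff.rfl ⟨fun h => h.2, fun h => ⟨h.1.trans_le hτa, h⟩⟩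
  rw [hrw, measureReal_union, measureReal_inter_of_disjoint_coords hU hind
    disjoint_compl_right hBm hAm, hunif _ _ hτ0 (hτa.trans ha)]
  · congr 1
    rw [hτ, div_mul_cancel₀ _ hadm.ne']
  · rw [Set.disjoint_left]
    exact fun ω h1 h2 => h2.2.1 h1
  · exact (coordAlgebra_le hU _ _ hBm).inter (coordAlgebra_le hU _ _ hAm)

lemma le_measureReal_inactive (hU : ∀ i, Measurable (U i))
    (hunif : ∀ i x, 0 ≤ x → x ≤ 1 → μ.real (U i ⁻¹' Set.Iio x) = x)
    (ha0 : 0 ≤ a) (ha : a ≤ 1) (t : ℕ) (b : ι) :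
    1 - t * a ≤ μ.real {ω | ∀ s < t, a ≤ U (s, b) ω} := by
  have hrw : {ω | ∀ s < t, a ≤ U (s, b) ω} = (⋃ s ∈ range t, U (s, b) ⁻¹' Set.Iio a)ᶜ := by
    ext ω
    simp
  rw [hrw, probReal_compl_eq_one_sub]
  · have := measureReal_biUnion_finset_le (μ := μ) (range t) fun s => U (s, b) ⁻¹' Set.Iio a
    simp only [hunif _ a ha0 ha, sum_const, card_range, nsmul_eq_mul] at this
    linarith
  · exact Finset.measurableSet_biUnion _ fun s _ => hU _ measurableSet_Iio

lemma measurableSet_inactive (t : ℕ) (b : ι) :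
    MeasurableSet[coordAlgebra U {i | i.2 = b}] {ω | ∀ s < t, a ≤ U (s, b) ω} := by
  have hrw : {ω | ∀ s < t, a ≤ U (s, b) ω} =
      ⋂ (s : ℕ) (_ : s < t), U (s, b) ⁻¹' Set.Ici a := by
    ext ω
    simp
  rw [hrw]
  refine MeasurableSet.iInter fun s => MeasurableSet.iInter fun _ => ?_
  have hmem : (s, b) ∈ {i : ℕ × ι | i.2 = b} := by simp
  exact measurableSet_coordAlgebra_preimage U hmem measurableSet_Ici

/-- The event that `c` is present or active at time `t` in the process without `b`. -/
def occupied (𝒞 : Finset (Finset ι)) (U : ℕ × ι → Ω → ℝ) (a : ℝ) (τ : ℕ → ι → ℝ) (b : ι)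
    (t : ℕ) (c : ι) : Set Ω :=
  {ω | c ∈ greedy 𝒞 U a τ (univ.erase b) t ω} ∪ U (t, c) ⁻¹' Set.Iio a

lemma measurableSet_occupied (b : ι) (t : ℕ) (c : ι) :
    MeasurableSet[coordAlgebra U {i | i.2 ∈ conflictBall 𝒞 (univ.erase b) t c}]
      (occupied 𝒞 U a τ b t c) := by
  refine MeasurableSet.union ?_ ?_
  · exact (measurableSet_mem_greedy t c).coordAlgebra_mono fun i hi => hi.2
  · exact measurableSet_coordAlgebra_preimage U (self_mem_conflictBall t c) measurableSet_Iio

lemma disjoint_inactive_coords {b c : ι} (hcb : c ≠ b) (t : ℕ) :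
    Disjoint {i : ℕ × ι | i.2 = b} {i | i.2 ∈ conflictBall 𝒞 (univ.erase b) t c} := by
  rw [Set.disjoint_left]
  rintro ⟨s, z⟩ rfl h2
  have := conflictBall_subset (mem_erase.2 ⟨hcb, mem_univ _⟩) t h2
  simp at this

lemma measureReal_occupied_mul_le (hU : ∀ i, Measurable (U i)) (hind : iIndepFun U μ)
    (hunif : ∀ i x, 0 ≤ x → x ≤ 1 → μ.real (U i ⁻¹' Set.Iio x) = x)
    (ha0 : 0 ≤ a) (ha : a ≤ 1) {b c : ι} (hcb : c ≠ b) (t : ℕ) :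
    μ.real (occupied 𝒞 U a τ b t c) * (1 - (t + 1) * a) ≤
      μ.real {ω | c ∈ greedy 𝒞 U a τ univ t ω} + a := by
  have h1 := le_measureReal_inactive hU hunif ha0 ha (t + 1) b
  push_cast at h1
  calc μ.real (occupied 𝒞 U a τ b t c) * (1 - (t + 1) * a)
      ≤ μ.real (occupied 𝒞 U a τ b t c) * μ.real {ω | ∀ s < t + 1, a ≤ U (s, b) ω} := by
        gcongr
    _ = μ.real ({ω | ∀ s < t + 1, a ≤ U (s, b) ω} ∩ occupied 𝒞 U a τ b t c) := by
        rw [mul_comm, measureReal_inter_of_disjoint_coords hU hind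
          (disjoint_inactive_coords hcb t) (measurableSet_inactive _ _)
          (measurableSet_occupied b t c)]
    _ ≤ μ.real ({ω | c ∈ greedy 𝒞 U a τ univ t ω} ∪ U (t, c) ⁻¹' Set.Iio a) := by
        refine measureReal_mono ?_
        rintro ω ⟨h2, h3⟩
        have h4 := greedy_eq_erase (𝒞 := 𝒞) (τ := τ) (t := t)
          fun s hs => h2 s (hs.trans (Nat.lt_succ_self t))
        rcases h3 with h3 | h3
        · left
          simpa [h4.1] using h3
        · exact Or.inr h3
    _ ≤ _ := by
        refine (measureReal_union_le _ _).trans ?_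
        rw [hunif _ _ ha0 ha]

lemma exp_neg_two_mul_le {x : ℝ} (h0 : 0 ≤ x) (h1 : x ≤ 1 / 2) : Real.exp (-(2 * x)) ≤ 1 - x := by
  rw [Real.exp_neg, inv_le_comm₀ (Real.exp_pos _) (by linarith)]
  refine le_trans ?_ (Real.add_one_le_exp (2 * x))
  rw [inv_le_iff_one_le_mul₀ (by linarith)]
  nlinarith

/-- Lower bound for the probability of admissibility, when conflicts through `b` lead to
disjoint parts of the conflict hypergraph. -/
lemma le_measureReal_admissible {γ : Type*} [DecidableEq γ] (hU : ∀ i, Measurable (U i))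
    (hind : iIndepFun U μ)
    (hunif : ∀ i x, 0 ≤ x → x ≤ 1 → μ.real (U i ⁻¹' Set.Iio x) = x)
    (ha0 : 0 ≤ a) (ha : a ≤ 1) (b : ι) (t : ℕ) (pr : ι → γ) {K : ℕ} {D C δ : ℝ}
    (hD2 : 2 ≤ D) (hδ0 : 0 ≤ δ) (hδ1 : δ ≤ 1) (hta : (t + 1) * a ≤ 1 / 2)
    (h2 : ∀ X ∈ 𝒞, 2 ≤ #X)
    (hK : #((univ.filter fun c => c ≠ b ∧ {b, c} ∈ 𝒞).image pr) ≤ K)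
    (hD : ∀ p, (#(univ.filter fun c => c ≠ b ∧ {b, c} ∈ 𝒞 ∧ pr c = p) : ℝ) ≤ D)
    (hC : ∑ X ∈ 𝒞 with b ∈ X ∧ 3 ≤ #X, (1 / D) ^ (#X - 1) ≤ C)
    (hsep : ∀ X ∈ 𝒞, ∀ X' ∈ 𝒞, b ∈ X → b ∈ X' → ∀ c ∈ X, ∀ c' ∈ X', c ≠ b → c' ≠ b →
      ∀ z ∈ conflictBall 𝒞 (univ.erase b) t c, z ∈ conflictBall 𝒞 (univ.erase b) t c' →
      (c = c' ∧ X = X') ∨ (#X = 2 ∧ #X' = 2 ∧ pr c = pr c'))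
    (hocc : ∀ c, c ≠ b → μ.real (occupied 𝒞 U a τ b t c) ≤ (1 - δ) / D) :
    1 / 2 * (δ ^ K * Real.exp (-(2 * C))) ≤
      μ.real (admissible 𝒞 U a univ (greedy 𝒞 U a τ univ t) t b) := by
  classical
  have hD0 : 0 < D := by linarith
  set Q := occupied 𝒞 U a τ b t with hQ
  set ball := conflictBall 𝒞 (univ.erase b) t with hball
  have hQm (c : ι) : MeasurableSet[coordAlgebra U {i | i.2 ∈ ball c}] (Q c) :=
    measurableSet_occupied b t c
  have hQ' (c : ι) : MeasurableSet (Q c) := coordAlgebra_le hU _ _ (hQm c)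
  set Y : γ → Finset ι := fun p => univ.filter fun c => c ≠ b ∧ {b, c} ∈ 𝒞 ∧ pr c = p with hY
  set P := (univ.filter fun c => c ≠ b ∧ {b, c} ∈ 𝒞).image pr with hP
  set R := 𝒞.filter fun X => b ∈ X ∧ 3 ≤ #X with hR
  let A : γ ⊕ Finset ι → Set Ω := Sum.elim (fun p => ⋂ c ∈ Y p, (Q c)ᶜ)
    (fun X => (⋂ c ∈ X.erase b, Q c)ᶜ)
  let J : γ ⊕ Finset ι → Set (ℕ × ι) := Sum.elim (fun p => ⋃ c ∈ Y p, {i | i.2 ∈ ball c})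
    (fun X => ⋃ c ∈ X.erase b, {i | i.2 ∈ ball c})
  have hAm : ∀ i, MeasurableSet[coordAlgebra U (J i)] (A i) := by
    rintro (p | X)
    · refine MeasurableSet.iInter fun c => MeasurableSet.iInter fun hc => MeasurableSet.compl ?_
      exact (hQm c).coordAlgebra_mono (Set.subset_biUnion_of_mem (s := (Y p : Set ι))
        (u := fun c => {i : ℕ × ι | i.2 ∈ ball c}) hc)
    · refine MeasurableSet.compl (MeasurableSet.iInter fun c => MeasurableSet.iInter fun hc => ?_)
      exact (hQm c).coordAlgebra_mono (Set.subset_biUnion_of_mem (s := (X.erase b : Set ι))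
        (u := fun c => {i : ℕ × ι | i.2 ∈ ball c}) hc)
  have hJ : ((P.disjSum R : Finset (γ ⊕ Finset ι)) : Set (γ ⊕ Finset ι)).PairwiseDisjoint J := by
    have key : ∀ i ∈ P.disjSum R, ∀ j ∈ J i, ∃ X ∈ 𝒞, b ∈ X ∧ ∃ c ∈ X, c ≠ b ∧ j.2 ∈ ball c ∧
        ((∃ p, i = Sum.inl p ∧ p = pr c ∧ #X = 2 ∧ X = {b, c}) ∨ (i = Sum.inr X ∧ 3 ≤ #X)) := by
      rintro (p | X) hi j hj
      · simp only [J, Sum.elim_inl, Set.mem_iUnion, Set.mem_ofPred_eq, hY, mem_filter,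
          mem_univ, true_and] at hj
        obtain ⟨c, ⟨h3, h4, h5⟩, h6⟩ := hj
        exact ⟨{b, c}, h4, by simp, c, by simp, h3, h6, Or.inl ⟨p, rfl, h5.symm,
          card_pair h3.symm, rfl⟩⟩
      · simp only [J, Sum.elim_inr, Set.mem_iUnion, Set.mem_ofPred_eq, mem_erase] at hj
        obtain ⟨c, ⟨h3, h4⟩, h6⟩ := hj
        simp only [hR, inr_mem_disjSum, mem_filter] at hi
        exact ⟨X, hi.1, hi.2.1, c, h4, h3, h6, Or.inr ⟨rfl, hi.2.2⟩⟩
    intro i hi i' hi' hne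
    rw [Function.onFun, Set.disjoint_left]
    intro j hj hj'
    apply hne
    obtain ⟨X, hX, hbX, c, hcX, hcb, hjc, h⟩ := key i hi j hj
    obtain ⟨X', hX', hbX', c', hcX', hcb', hjc', h'⟩ := key i' hi' j hj'
    have h3 := hsep X hX X' hX' hbX hbX' c hcX c' hcX' hcb hcb' j.2 hjc hjc'
    rcases h with ⟨p, rfl, rfl, h4, rfl⟩ | ⟨rfl, h4⟩ <;>
      rcases h' with ⟨p', rfl, rfl, h5, rfl⟩ | ⟨rfl, h5⟩ <;>
      rcases h3 with ⟨h6, h7⟩ | ⟨h6, h7, h8⟩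
    · rw [h6]
    · rw [h8]
    · rw [h7] at h4; omega
    · omega
    · rw [h7] at h4; omega
    · omega
    · rw [h7]
    · omega
  obtain ⟨hAll, hprod⟩ := measureReal_biInter_of_disjoint_coords hU hind (P.disjSum R) A J
    (fun i _ => hAm i) hJ
  have hlowP : ∀ p ∈ P, δ ≤ μ.real (A (Sum.inl p)) := by
    intro p _
    have hrw : A (Sum.inl p) = (⋃ c ∈ Y p, Q c)ᶜ := by
      simp [A, Set.compl_iUnion]
    rw [hrw, probReal_compl_eq_one_sub (Finset.measurableSet_biUnion _ fun c _ => hQ' c)]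
    have h3 := measureReal_biUnion_finset_le (μ := μ) (Y p) Q
    have h4 : ∑ c ∈ Y p, μ.real (Q c) ≤ ∑ c ∈ Y p, (1 - δ) / D :=
      sum_le_sum fun c hc => hocc c (mem_filter.1 hc).2.1
    rw [sum_const, nsmul_eq_mul] at h4
    have h5 : (#(Y p) : ℝ) * ((1 - δ) / D) ≤ D * ((1 - δ) / D) :=
      mul_le_mul_of_nonneg_right (hD p) (div_nonneg (by linarith) hD0.le)
    rw [mul_div_cancel₀ _ hD0.ne'] at h5
    linarith
  have hlowR : ∀ X ∈ R, Real.exp (-(2 * (1 / D) ^ (#X - 1))) ≤ μ.real (A (Sum.inr X)) := by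
    intro X hX
    obtain ⟨hX𝒞, hbX, hX3⟩ := mem_filter.1 hX
    have hdis : ((X.erase b : Finset ι) : Set ι).PairwiseDisjoint
        fun c => {i : ℕ × ι | i.2 ∈ ball c} := by
      intro c hc c' hc' hne
      rw [Function.onFun, Set.disjoint_left]
      intro j hj hj'
      simp only [coe_erase, Set.mem_sdiff, mem_coe, Set.mem_singleton_iff] at hc hc'
      rcases hsep X hX𝒞 X hX𝒞 hbX hbX c hc.1 c' hc'.1 hc.2 hc'.2 j.2 hj hj' with h | h
      · exact hne h.1
      · omega
    obtain ⟨h3, h4⟩ := measureReal_biInter_of_disjoint_coords hU hind (X.erase b) Q _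
      (fun c _ => hQm c) hdis
    have h5 : ∏ c ∈ X.erase b, μ.real (Q c) ≤ ∏ c ∈ X.erase b, (1 / D) := by
      refine prod_le_prod (fun _ _ => measureReal_nonneg) fun c hc => ?_
      refine (hocc c (ne_of_mem_erase hc)).trans ?_
      gcongr
      linarith
    rw [prod_const, card_erase_of_mem hbX] at h5
    have h6 : A (Sum.inr X) = (⋂ c ∈ X.erase b, Q c)ᶜ := rfl
    rw [h6, probReal_compl_eq_one_sub (coordAlgebra_le hU _ _ h3), h4]
    refine (exp_neg_two_mul_le (by positivity) ?_).trans (by linarith)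
    have h7 : (1 / D) ≤ 1 / 2 := by gcongr
    calc (1 / D) ^ (#X - 1) ≤ (1 / D) ^ 1 :=
          pow_le_pow_of_le_one (by positivity) (by linarith) (by omega)
      _ ≤ 1 / 2 := by simpa using h7
  have hlow : δ ^ K * Real.exp (-(2 * C)) ≤ μ.real (⋂ i ∈ P.disjSum R, A i) := by
    rw [hprod, prod_disjSum]
    refine mul_le_mul ?_ ?_ (Real.exp_pos _).le (prod_nonneg fun _ _ => measureReal_nonneg)
    · calc δ ^ K ≤ δ ^ #P := pow_le_pow_of_le_one hδ0 hδ1 hK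
        _ = ∏ p ∈ P, δ := by rw [prod_const]
        _ ≤ _ := prod_le_prod (fun _ _ => hδ0) hlowP
    · calc Real.exp (-(2 * C)) ≤ Real.exp (∑ X ∈ R, -(2 * (1 / D) ^ (#X - 1))) := by
            rw [sum_neg_distrib, ← mul_sum]
            gcongr
        _ = ∏ X ∈ R, Real.exp (-(2 * (1 / D) ^ (#X - 1))) := Real.exp_sum _ _
        _ ≤ _ := prod_le_prod (fun _ _ => (Real.exp_pos _).le) hlowR
  have hdisj : Disjoint {i : ℕ × ι | i.2 = b} (⋃ i ∈ P.disjSum R, J i) := by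
    simp only [Set.disjoint_iUnion_right]
    rintro (p | X) hi
    · simp only [J, Sum.elim_inl, Set.disjoint_iUnion_right]
      exact fun c hc => disjoint_inactive_coords (mem_filter.1 hc).2.1 t
    · simp only [J, Sum.elim_inr, Set.disjoint_iUnion_right]
      exact fun c hc => disjoint_inactive_coords (ne_of_mem_erase hc) t
  have hN := le_measureReal_inactive hU hunif ha0 ha (t + 1) b
  push_cast at hN
  calc 1 / 2 * (δ ^ K * Real.exp (-(2 * C)))
      ≤ μ.real {ω | ∀ s < t + 1, a ≤ U (s, b) ω} * μ.real (⋂ i ∈ P.disjSum R, A i) := by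
        refine mul_le_mul (by linarith) hlow (by positivity) measureReal_nonneg
    _ = μ.real ({ω | ∀ s < t + 1, a ≤ U (s, b) ω} ∩ ⋂ i ∈ P.disjSum R, A i) := by
        rw [measureReal_inter_of_disjoint_coords hU hind hdisj (measurableSet_inactive _ _) hAll]
    _ ≤ _ := by
        refine measureReal_mono ?_
        rintro ω ⟨h3, h4⟩
        obtain ⟨h5, h6⟩ := greedy_eq_erase (𝒞 := 𝒞) (τ := τ) (t := t)
          fun s hs => h3 s (hs.trans (Nat.lt_succ_self t))
        refine ⟨h6, fun X hX hbX _ => ?_⟩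
        simp only [Set.mem_iInter] at h4
        have hfree : ∃ c ∈ X, c ≠ b ∧ ω ∉ Q c := by
          by_cases hX3 : 3 ≤ #X
          · have := h4 (Sum.inr X) (by simp [hR, hX, hbX, hX3])
            simp only [A, Sum.elim_inr, Set.mem_compl_iff, Set.mem_iInter, mem_erase,
              not_forall] at this
            obtain ⟨c, hc, h7⟩ := this
            exact ⟨c, hc.2, hc.1, h7⟩
          · have hX2 : #X = 2 := le_antisymm (by omega) (h2 X hX)
            obtain ⟨c, hc, hcb⟩ := exists_mem_ne (s := X) (by omega) b
            have hXe : X = {b, c} := by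
              symm
              refine eq_of_subset_of_card_le ?_ ?_
              · simp [insert_subset_iff, hbX, hc]
              · rw [hX2, card_pair hcb.symm]
            have h7 : {b, c} ∈ 𝒞 := hXe ▸ hX
            have := h4 (Sum.inl (pr c)) (by
              simp only [hP, inl_mem_disjSum, mem_image, mem_filter, mem_univ, true_and]
              exact ⟨c, ⟨hcb, h7⟩, rfl⟩)
            simp only [A, Sum.elim_inl, Set.mem_compl_iff, Set.mem_iInter] at this
            exact ⟨c, hc, hcb, this c (by simp [hY, hcb, h7])⟩
        obtain ⟨c, hcX, hcb, h7⟩ := hfree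
        simp only [hQ, occupied, Set.mem_union, Set.mem_ofPred_eq, Set.mem_preimage, Set.mem_Iio,
          not_or, not_lt] at h7
        exact ⟨c, hcX, hcb, h5 ▸ h7.1, h7.2⟩

end Balance

lemma conflictBall_mono {ι : Type*} (𝒞 : Finset (Finset ι)) (f : Finset ι) {s t : ℕ}
    (h : s ≤ t) (c : ι) : conflictBall 𝒞 f s c ⊆ conflictBall 𝒞 f t c := by
  induction t, h using Nat.le_induction with
  | base => exact le_rfl
  | succ t _ ih => exact ih.trans fun z hz => Or.inl hz

/-- Independent uniform variables on a common probability space. -/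
lemma exists_iIndepFun_uniform (I : Type) : ∃ (Ω : Type) (_ : MeasurableSpace Ω) (μ : Measure Ω)
    (_ : IsProbabilityMeasure μ) (U : I → Ω → ℝ), (∀ i, Measurable (U i)) ∧ iIndepFun U μ ∧
    ∀ i x, 0 ≤ x → x ≤ 1 → μ.real (U i ⁻¹' Set.Iio x) = x := by
  refine ⟨I → unitInterval, inferInstance, Measure.infinitePi fun _ => volume, inferInstance,
    fun i ω => (ω i : ℝ), fun i => measurable_subtype_coe.comp (measurable_pi_apply i), ?_, ?_⟩
  · exact iIndepFun_infinitePi (X := fun _ (x : unitInterval) => (x : ℝ))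
      (fun _ => measurable_subtype_coe)
  · intro i x h0 h1
    have hrw : (fun ω : I → unitInterval => (ω i : ℝ)) ⁻¹' Set.Iio x =
        (fun ω : I → unitInterval => ω i) ⁻¹' Set.Iio (⟨x, h0, h1⟩ : unitInterval) := by
      ext ω
      simp [← Subtype.coe_lt_coe]
    have h := (measurePreserving_eval_infinitePi (fun _ : I => (volume : Measure unitInterval)) i)
    rw [hrw, Measure.real, h.measure_preimage measurableSet_Iio.nullMeasurableSet,
      unitInterval.volume_Iio]
    simp [h0]

/-- A conflict system in which each element has conflicting pairs of at most `K` kinds, at most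
`D` of each kind, and which is otherwise sparse and locally treelike, admits a conflict-free
subset containing almost a `1/D` proportion of any prescribed set. -/
theorem exists_conflict_free (K : ℕ) {C ε : ℝ} (hε0 : 0 < ε) (hε1 : ε < 1) :
    ∃ (T : ℕ) (D₀ : ℝ), ∀ D : ℝ, D₀ ≤ D → ∀ (ι γ : Type) [Fintype ι] [DecidableEq ι]
      [DecidableEq γ] (𝒞 : Finset (Finset ι)) (pr : ι → ι → γ) (B : Finset ι),
      (∀ X ∈ 𝒞, 2 ≤ #X) →
      (∀ b, #((univ.filter fun c => c ≠ b ∧ {b, c} ∈ 𝒞).image (pr b)) ≤ K) →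
      (∀ b p, (#(univ.filter fun c => c ≠ b ∧ {b, c} ∈ 𝒞 ∧ pr b c = p) : ℝ) ≤ D) →
      (∀ b, ∑ X ∈ 𝒞 with b ∈ X ∧ 3 ≤ #X, (1 / D) ^ (#X - 1) ≤ C) →
      (∀ b, ∀ X ∈ 𝒞, ∀ X' ∈ 𝒞, b ∈ X → b ∈ X' → ∀ c ∈ X, ∀ c' ∈ X', c ≠ b → c' ≠ b →
        ∀ z ∈ conflictBall 𝒞 (univ.erase b) T c, z ∈ conflictBall 𝒞 (univ.erase b) T c' →
        (c = c' ∧ X = X') ∨ (#X = 2 ∧ #X' = 2 ∧ pr b c = pr b c')) →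
      ∃ M ⊆ B, (∀ X ∈ 𝒞, ¬ X ⊆ M) ∧ (1 - ε) * #B / D ≤ #M := by
  set δ := ε / 2 with hδ
  set κ := 1 / 2 * (δ ^ K * Real.exp (-(2 * C))) with hκ
  have hκ0 : 0 < κ := by positivity
  obtain ⟨T, hT⟩ := exists_nat_ge (max 1 (4 / (κ * ε)))
  have hT1 : (1 : ℝ) ≤ T := (le_max_left _ _).trans hT
  have hT2 : 4 / (κ * ε) ≤ T := (le_max_right _ _).trans hT
  refine ⟨T, max 2 (8 / (κ * ε)), ?_⟩
  intro D hD0 ι γ _ _ _ 𝒞 pr B h2 hK hD hC hsep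
  have hD2 : 2 ≤ D := (le_max_left _ _).trans hD0
  have hD8 : 8 / (κ * ε) ≤ D := (le_max_right _ _).trans hD0
  have hDpos : 0 < D := by linarith
  have hTpos : (0 : ℝ) < T := by linarith
  set q := (1 - ε) / T / D with hq
  set a := q / κ with ha
  have hq0 : 0 ≤ q := div_nonneg (div_nonneg (by linarith) hTpos.le) hDpos.le
  have ha0 : 0 ≤ a := div_nonneg hq0 hκ0.le
  have hTa : T * a ≤ ε / 8 := by
    have h3 : T * a = (1 - ε) / (κ * D) := by
      rw [ha, hq]; field_simp
    rw [h3, div_le_iff₀ (by positivity)]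
    rw [div_le_iff₀ (by positivity)] at hD8
    nlinarith
  have haD : a * D ≤ ε / 4 := by
    have h3 : a * D = (1 - ε) / (κ * T) := by
      rw [ha, hq]; field_simp
    rw [h3, div_le_iff₀ (by positivity)]
    rw [div_le_iff₀ (by positivity)] at hT2
    nlinarith
  have ha1 : a ≤ 1 := by nlinarith
  have hTq : T * q = (1 - ε) / D := by
    rw [hq]; field_simp
  obtain ⟨Ω, mΩ, μ, hμ, U, hU, hind, hunif⟩ := exists_iIndepFun_uniform (ℕ × ι)
  obtain ⟨τ, hτ⟩ := exists_balanced_thresholds μ 𝒞 U a q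
  have hprob : ∀ t ≤ T, ∀ c, μ.real {ω | c ∈ greedy 𝒞 U a τ univ t ω} = t * q := by
    intro t
    induction t with
    | zero => simp [greedy]
    | succ t ih =>
      intro ht b
      have ih' := ih (by omega)
      have htT : (t : ℝ) + 1 ≤ T := by exact_mod_cast ht
      have hta : (t + 1) * a ≤ ε / 8 := (mul_le_mul_of_nonneg_right htT ha0).trans hTa
      have hadm : ∀ b, κ ≤ μ.real (admissible 𝒞 U a univ (greedy 𝒞 U a τ univ t) t b) := by
        intro b
        refine le_measureReal_admissible hU hind hunif ha0 ha1 b t (pr b) (K := K) (D := D)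
          (C := C) (δ := δ) hD2 (by positivity) (by linarith) (by linarith) h2 (hK b) (hD b) (hC b)
          ?_ ?_
        · intro X hX X' hX' hbX hbX' c hc c' hc' hcb hcb' z hz hz'
          exact hsep b X hX X' hX' hbX hbX' c hc c' hc' hcb hcb' z
            (conflictBall_mono _ _ (by omega) _ hz) (conflictBall_mono _ _ (by omega) _ hz')
        · intro c hcb
          have h3 := measureReal_occupied_mul_le (𝒞 := 𝒞) (τ := τ) hU hind hunif ha0 ha1 hcb t
          rw [ih' c] at h3
          have h4 : (t : ℝ) * q ≤ (1 - ε) / D := by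
            rw [← hTq]
            exact mul_le_mul_of_nonneg_right (by linarith) hq0
          set x := μ.real (occupied 𝒞 U a τ b t c) with hx
          have hx0 : 0 ≤ x := measureReal_nonneg
          rw [le_div_iff₀ hDpos]
          have h5 : x * (1 - ε / 8) ≤ (1 - ε) / D + a :=
            le_trans (mul_le_mul_of_nonneg_left (by linarith) hx0) (h3.trans (by linarith))
          have h6 : x * (1 - ε / 8) * D ≤ ((1 - ε) / D + a) * D :=
            mul_le_mul_of_nonneg_right h5 hDpos.le
          rw [add_mul, div_mul_cancel₀ _ hDpos.ne'] at h6
          have h7 : x * D * (1 - ε / 8) ≤ (1 - δ) * (1 - ε / 8) := by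
            rw [hδ]; nlinarith
          exact le_of_mul_le_mul_right h7 (by linarith)
      have hb := hadm b
      have hτa : τ t b ≤ a := by
        rw [hτ, ha]
        gcongr
      have hτ0 : 0 ≤ τ t b := by
        rw [hτ]
        exact div_nonneg hq0 measureReal_nonneg
      rw [measureReal_mem_greedy_succ hU hind hunif (hκ0.trans_le hb) (hτ t b) hτ0 hτa ha1, ih' b]
      push_cast
      ring
  classical
  have hmeas (b : ι) : MeasurableSet {ω | b ∈ greedy 𝒞 U a τ univ T ω} :=
    coordAlgebra_le hU _ _ (measurableSet_mem_greedy T b)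
  have h_int (b : ι) :
      Integrable ({ω | b ∈ greedy 𝒞 U a τ univ T ω}.indicator (1 : Ω → ℝ)) μ :=
    (integrable_const (1 : ℝ)).indicator (hmeas b)
  obtain ⟨ω, hω⟩ := exists_integral_le (μ := μ)
    (f := fun ω => ∑ b ∈ B, {ω | b ∈ greedy 𝒞 U a τ univ T ω}.indicator (1 : Ω → ℝ) ω)
    (integrable_finsetSum _ fun b _ => h_int b)
  rw [integral_finsetSum _ fun b _ => h_int b] at hω
  simp only [integral_indicator_one (hmeas _), hprob T le_rfl, sum_const, nsmul_eq_mul, hTq] at hω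
  refine ⟨B.filter fun b => b ∈ greedy 𝒞 U a τ univ T ω, filter_subset _ _, ?_, ?_⟩
  · intro X hX hXM
    refine greedy_not_subset (𝒞 := 𝒞) (U := U) (a := a) (τ := τ) (f := univ) ?_ T ω hX
      (subset_univ _) fun z hz => (mem_filter.1 (hXM hz)).2
    intro h
    have := h2 _ h
    simp at this
  · calc (1 - ε) * #B / D = #B * ((1 - ε) / D) := by ring
      _ ≤ _ := hω
      _ = _ := by simp [Set.indicator_apply, sum_boole]

end GreedyConflictFree

section RandomBlocks

lemma card_filter_forall_mem {α : Type*} [Fintype α] [DecidableEq α] [Nonempty α] {N : ℕ}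
    (I : Finset (Fin N)) (Z : Finset α) :
    (#{β : Fin N → α | ∀ b ∈ I, β b ∈ Z} : ℝ) =
      (Fintype.card α : ℝ) ^ N * ((#Z : ℝ) / Fintype.card α) ^ #I := by
  have h1 : (univ.filter fun β : Fin N → α => ∀ b ∈ I, β b ∈ Z) =
      Fintype.piFinset fun b => if b ∈ I then Z else univ := by
    ext β
    simp only [mem_filter, mem_univ, true_and, Fintype.mem_piFinset]
    refine forall_congr' fun b => ?_
    by_cases hb : b ∈ I <;> simp [hb]
  have h2 : #I ≤ N := by simpa using card_le_univ I
  have h3 : #(univ.filter fun b => b ∉ I) = N - #I := by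
    rw [filter_not, filter_mem_eq_inter, univ_inter, ← compl_eq_univ_sdiff, card_compl,
      Fintype.card_fin]
  have h0 : (Fintype.card α : ℝ) ≠ 0 := by exact_mod_cast Fintype.card_ne_zero
  rw [h1, Fintype.card_piFinset]
  simp only [apply_ite card, prod_ite, prod_const, h3, filter_mem_eq_inter, univ_inter, card_univ]
  push_cast
  rw [div_pow, ← mul_div_assoc, mul_comm, eq_div_iff (pow_ne_zero _ h0), mul_right_comm, ← pow_add,
    Nat.sub_add_cancel h2]

variable {N m n : ℕ}

/-- The vertices covered by the blocks with index in `I`. -/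
def blockSpan (β : Fin N → Fin m → Fin n) (I : Finset (Fin N)) : Finset (Fin n) :=
  I.biUnion fun b => univ.image (β b)

lemma card_blockSpan_le (hn : 0 < n) (I : Finset (Fin N)) {v : ℕ} (hv : v ≤ n) :
    (#{β : Fin N → Fin m → Fin n | #(blockSpan β I) ≤ v} : ℝ) ≤
      (n ^ m : ℝ) ^ N * (n ^ v * ((v : ℝ) ^ m / n ^ m) ^ #I) := by
  have : Nonempty (Fin n) := ⟨⟨0, hn⟩⟩
  have h1 : (univ.filter fun β : Fin N → Fin m → Fin n => #(blockSpan β I) ≤ v) ⊆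
      (powersetCard v (univ : Finset (Fin n))).biUnion fun W =>
        univ.filter fun β : Fin N → Fin m → Fin n =>
          ∀ b ∈ I, β b ∈ Fintype.piFinset fun _ : Fin m => W := by
    intro β hβ
    simp only [mem_filter, mem_univ, true_and] at hβ
    obtain ⟨W, hW1, hW2⟩ := exists_superset_card_eq hβ (by simpa using hv)
    simp only [mem_biUnion, mem_powersetCard, subset_univ, true_and, mem_filter, mem_univ,
      Fintype.mem_piFinset]
    refine ⟨W, hW2, fun b hb i => hW1 ?_⟩
    exact mem_biUnion.2 ⟨b, hb, mem_image_of_mem _ (mem_univ _)⟩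
  have h2 : ∀ W ∈ powersetCard v (univ : Finset (Fin n)),
      (#(univ.filter fun β : Fin N → Fin m → Fin n =>
          ∀ b ∈ I, β b ∈ Fintype.piFinset fun _ : Fin m => W) : ℝ) =
      (n ^ m : ℝ) ^ N * ((v : ℝ) ^ m / n ^ m) ^ #I := by
    intro W hW
    rw [card_filter_forall_mem, Fintype.card_piFinset]
    simp [(mem_powersetCard.1 hW).2]
  calc (#{β : Fin N → Fin m → Fin n | #(blockSpan β I) ≤ v} : ℝ)
      ≤ ∑ W ∈ powersetCard v (univ : Finset (Fin n)),
        (#(univ.filter fun β : Fin N → Fin m → Fin n =>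
          ∀ b ∈ I, β b ∈ Fintype.piFinset fun _ : Fin m => W) : ℝ) := by
        exact_mod_cast (card_le_card h1).trans card_biUnion_le
    _ = (n.choose v : ℝ) * ((n ^ m : ℝ) ^ N * ((v : ℝ) ^ m / n ^ m) ^ #I) := by
        rw [sum_congr rfl h2, sum_const, card_powersetCard]
        simp
    _ ≤ (n : ℝ) ^ v * ((n ^ m : ℝ) ^ N * ((v : ℝ) ^ m / n ^ m) ^ #I) := by
        gcongr
        exact_mod_cast Nat.choose_le_pow n v
    _ = _ := by ring

/-- Index sets of size `s` whose blocks span at most `v` vertices. -/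
def denseSets (β : Fin N → Fin m → Fin n) (s v : ℕ) : Finset (Finset (Fin N)) :=
  (powersetCard s univ).filter fun I => #(blockSpan β I) ≤ v

lemma sum_card_denseSets_le (hn : 0 < n) (hm : 2 ≤ m) {D : ℝ} (hN : (N : ℝ) ≤ D * n ^ 2)
    {s r : ℕ} (hv : (m - 2) * s + r ≤ n) :
    ∑ β : Fin N → Fin m → Fin n, (#(denseSets β s ((m - 2) * s + r)) : ℝ) ≤
      (n ^ m : ℝ) ^ N * (D ^ s * ((((m - 2) * s + r : ℕ) : ℝ) ^ m) ^ s * n ^ r) := by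
  set v := (m - 2) * s + r with hvdef
  have hn' : (0 : ℝ) < n := by exact_mod_cast hn
  have hD : 0 ≤ D := by
    by_contra h
    have h1 : D * (n : ℝ) ^ 2 < 0 := mul_neg_of_neg_of_pos (not_le.1 h) (by positivity)
    have : (0 : ℝ) ≤ N := by positivity
    linarith
  have h1 : ∑ β : Fin N → Fin m → Fin n, (#(denseSets β s v) : ℝ) =
      ∑ I ∈ powersetCard s (univ : Finset (Fin N)),
        (#{β : Fin N → Fin m → Fin n | #(blockSpan β I) ≤ v} : ℝ) := by
    simp only [denseSets, card_filter, Nat.cast_sum]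
    exact sum_comm
  have h2 : ∑ I ∈ powersetCard s (univ : Finset (Fin N)),
        (#{β : Fin N → Fin m → Fin n | #(blockSpan β I) ≤ v} : ℝ) ≤
      ∑ I ∈ powersetCard s (univ : Finset (Fin N)),
        (n ^ m : ℝ) ^ N * (n ^ v * ((v : ℝ) ^ m / n ^ m) ^ s) := by
    refine sum_le_sum fun I hI => ?_
    have := card_blockSpan_le (N := N) (m := m) hn I hv
    rwa [(mem_powersetCard.1 hI).2] at this
  rw [h1]
  refine h2.trans ?_
  rw [sum_const, card_powersetCard, card_univ, Fintype.card_fin, nsmul_eq_mul]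
  have h3 : (N.choose s : ℝ) ≤ (D * n ^ 2) ^ s :=
    calc (N.choose s : ℝ) ≤ (N : ℝ) ^ s := by exact_mod_cast Nat.choose_le_pow N s
      _ ≤ _ := by gcongr
  calc (N.choose s : ℝ) * ((n ^ m : ℝ) ^ N * (n ^ v * ((v : ℝ) ^ m / n ^ m) ^ s))
      ≤ (D * n ^ 2) ^ s * ((n ^ m : ℝ) ^ N * (n ^ v * ((v : ℝ) ^ m / n ^ m) ^ s)) := by
        gcongr
    _ = (n ^ m : ℝ) ^ N * (D ^ s * ((v : ℝ) ^ m) ^ s * ((n ^ 2) ^ s * n ^ v / (n ^ m) ^ s)) := by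
        rw [div_pow, mul_pow]; ring
    _ = _ := by
        congr 2
        rw [div_eq_iff (by positivity), ← pow_mul, ← pow_mul, ← pow_add, ← pow_add]
        congr 1
        obtain ⟨w, rfl⟩ := Nat.exists_eq_add_of_le hm
        rw [hvdef, Nat.add_sub_cancel_left]
        ring

/-- The blocks containing both `x` and `y`. -/
def pairBlocks (β : Fin N → Fin m → Fin n) (x y : Fin n) : Finset (Fin N) :=
  univ.filter fun b => x ∈ univ.image (β b) ∧ y ∈ univ.image (β b)

lemma card_pair_mem_range_le {x y : Fin n} (hxy : x ≠ y) :
    #{r : Fin m → Fin n | x ∈ univ.image r ∧ y ∈ univ.image r} * n ^ 2 ≤ m ^ 2 * n ^ m := by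
  have h1 : (univ.filter fun r : Fin m → Fin n => x ∈ univ.image r ∧ y ∈ univ.image r) ⊆
      (univ : Finset (Fin m × Fin m)).biUnion fun ij =>
        univ.filter fun r : Fin m → Fin n => r ij.1 = x ∧ r ij.2 = y := by
    intro r hr
    simp only [mem_filter, mem_univ, true_and, mem_image] at hr
    obtain ⟨⟨i, hi⟩, j, hj⟩ := hr
    simp only [mem_biUnion, mem_filter, mem_univ, true_and]
    exact ⟨(i, j), hi, hj⟩
  have h2 : ∀ ij : Fin m × Fin m,
      #(univ.filter fun r : Fin m → Fin n => r ij.1 = x ∧ r ij.2 = y) * n ^ 2 ≤ n ^ m := by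
    rintro ⟨i, j⟩
    by_cases hij : i = j
    · subst hij
      rw [filter_false_of_mem]
      · simp
      · rintro r - ⟨h3, h4⟩
        exact hxy (h3.symm.trans h4)
    · have h3 : #((univ.filter fun r : Fin m → Fin n => r i = x ∧ r j = y) ×ˢ
          (univ : Finset (Fin n × Fin n))) ≤ #(univ : Finset (Fin m → Fin n)) := by
        refine card_le_card_of_injOn
          (fun p => Function.update (Function.update p.1 i p.2.1) j p.2.2) (by simp) ?_
        rintro ⟨r, u, w⟩ h ⟨r', u', w'⟩ h' heq
        simp only [coe_product, Set.mem_prod, mem_coe, mem_filter, mem_univ, true_and,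
          and_true] at h h'
        have hval := fun l => congrFun heq l
        simp only [Function.update_apply] at hval
        have hi := hval i
        have hj := hval j
        simp only [hij, if_true, if_false] at hi hj
        refine Prod.ext (funext fun l => ?_) (Prod.ext hi hj)
        have hl := hval l
        by_cases hlj : l = j
        · subst hlj
          exact h.2.trans h'.2.symm
        · by_cases hli : l = i
          · subst hli
            exact h.1.trans h'.1.symm
          · simpa [hlj, hli] using hl
      rw [card_product] at h3
      simpa [sq] using h3
  calc #{r : Fin m → Fin n | x ∈ univ.image r ∧ y ∈ univ.image r} * n ^ 2
      ≤ (∑ ij : Fin m × Fin m,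
        #(univ.filter fun r : Fin m → Fin n => r ij.1 = x ∧ r ij.2 = y)) * n ^ 2 :=
        Nat.mul_le_mul_right _ ((card_le_card h1).trans card_biUnion_le)
    _ = ∑ ij : Fin m × Fin m,
        #(univ.filter fun r : Fin m → Fin n => r ij.1 = x ∧ r ij.2 = y) * n ^ 2 := sum_mul _ _ _
    _ ≤ ∑ _ij : Fin m × Fin m, n ^ m := sum_le_sum fun ij _ => h2 ij
    _ = m ^ 2 * n ^ m := by simp [sq]

lemma sum_sq_card_sub_mean_le {α : Type*} [Fintype α] [DecidableEq α] [Nonempty α] (N : ℕ)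
    (Z : Finset α) :
    ∑ β : Fin N → α, ((#{b | β b ∈ Z} : ℝ) - N * (#Z / Fintype.card α)) ^ 2 ≤
      (Fintype.card α : ℝ) ^ N * (N * (#Z / Fintype.card α)) := by
  set p : ℝ := #Z / Fintype.card α with hp
  set P : ℝ := (Fintype.card α : ℝ) ^ N with hP
  have hp0 : 0 ≤ p := by positivity
  have hP0 : 0 ≤ P := by positivity
  have hd (β : Fin N → α) : (#{b | β b ∈ Z} : ℝ) = ∑ b, if β b ∈ Z then (1 : ℝ) else 0 := by
    simp
  have h1 : ∑ β : Fin N → α, (#{b | β b ∈ Z} : ℝ) = P * (N * p) := by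
    simp only [hd]
    rw [sum_comm]
    have h3 : ∀ b : Fin N, ∑ β : Fin N → α, (if β b ∈ Z then (1 : ℝ) else 0) = P * p := by
      intro b
      have h := card_filter_forall_mem (α := α) {b} Z
      simp only [mem_singleton, forall_eq, card_singleton, pow_one] at h
      rw [← h]
      simp
    rw [sum_congr rfl fun b _ => h3 b]
    simp
    ring
  have h2 : ∑ β : Fin N → α, (#{b | β b ∈ Z} : ℝ) ^ 2 ≤ P * (N ^ 2 * p ^ 2 + N * p) := by
    have h3 : ∀ b b' : Fin N, ∑ β : Fin N → α, ((if β b ∈ Z then (1 : ℝ) else 0) *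
        (if β b' ∈ Z then (1 : ℝ) else 0)) ≤ P * p ^ 2 + if b = b' then P * p else 0 := by
      intro b b'
      have h4 : ∀ β : Fin N → α, ((if β b ∈ Z then (1 : ℝ) else 0) *
        (if β b' ∈ Z then (1 : ℝ) else 0)) = if ∀ c ∈ ({b, b'} : Finset (Fin N)), β c ∈ Z
          then 1 else 0 := by
        intro β
        simp only [mem_insert, mem_singleton, forall_eq_or_imp, forall_eq]
        split_ifs <;> simp_all
      have h := card_filter_forall_mem (α := α) {b, b'} Z
      rw [sum_congr rfl fun β _ => h4 β, sum_boole, h]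
      by_cases hb : b = b'
      · subst hb
        have h6 : 0 ≤ P * p ^ 2 := by positivity
        rw [if_pos rfl, pair_eq_singleton, card_singleton, pow_one]
        linarith
      · rw [card_pair hb, if_neg hb, add_zero]
    calc ∑ β : Fin N → α, (#{b | β b ∈ Z} : ℝ) ^ 2
        = ∑ b, ∑ b', ∑ β : Fin N → α, ((if β b ∈ Z then (1 : ℝ) else 0) *
          (if β b' ∈ Z then (1 : ℝ) else 0)) := by
          simp only [hd, sq, sum_mul_sum]
          rw [sum_comm]
          exact sum_congr rfl fun b _ => sum_comm
      _ ≤ ∑ b : Fin N, ∑ b' : Fin N, (P * p ^ 2 + if b = b' then P * p else 0) :=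
          sum_le_sum fun b _ => sum_le_sum fun b' _ => h3 b b'
      _ = _ := by
          simp [sum_add_distrib]
          ring
  have h5 : ∑ β : Fin N → α, ((#{b | β b ∈ Z} : ℝ) - N * p) ^ 2 =
      ∑ β : Fin N → α, (#{b | β b ∈ Z} : ℝ) ^ 2 -
        2 * (N * p) * ∑ β : Fin N → α, (#{b | β b ∈ Z} : ℝ) + P * (N * p) ^ 2 := by
    simp only [sub_sq, sum_add_distrib, sum_sub_distrib, mul_sum]
    congr 1
    · congr 1
      exact sum_congr rfl fun β _ => by ring
    · simp [hP]
  rw [h5, h1]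
  linarith

lemma sum_pairBlocks_excess_le (hn : 0 < n) {x y : Fin n} (hxy : x ≠ y) {D η : ℝ} (hD : 0 < D)
    (hη0 : 0 < η) (hη1 : η < 1) (hm : 0 < m) (hN : (N : ℝ) ≤ (1 - η) * D * n ^ 2 / m ^ 2) :
    ∑ β : Fin N → Fin m → Fin n,
      (if D < #(pairBlocks β x y) then (#(pairBlocks β x y) : ℝ) else 0) ≤
      (n ^ m : ℝ) ^ N * (1 / η ^ 2) := by
  have : Nonempty (Fin n) := ⟨⟨0, hn⟩⟩
  have hn' : (0 : ℝ) < n := by exact_mod_cast hn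
  have hm' : (0 : ℝ) < m := by exact_mod_cast hm
  set Z : Finset (Fin m → Fin n) :=
    univ.filter fun r => x ∈ univ.image r ∧ y ∈ univ.image r with hZ
  have hvar := sum_sq_card_sub_mean_le N Z
  have hcard : (Fintype.card (Fin m → Fin n) : ℝ) = n ^ m := by simp
  rw [hcard] at hvar
  set l : ℝ := N * (#Z / (n : ℝ) ^ m) with hl
  have hd (β : Fin N → Fin m → Fin n) : #{b | β b ∈ Z} = #(pairBlocks β x y) := by
    simp [hZ, pairBlocks]
  simp only [hd] at hvar
  have hp : (#Z / (n : ℝ) ^ m) ≤ m ^ 2 / n ^ 2 := by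
    rw [div_le_div_iff₀ (by positivity) (by positivity)]
    exact_mod_cast card_pair_mem_range_le (m := m) hxy
  have hl1 : l ≤ (1 - η) * D := by
    calc l ≤ (1 - η) * D * n ^ 2 / m ^ 2 * (m ^ 2 / n ^ 2) := by
          rw [hl]
          have : (0 : ℝ) ≤ N := by positivity
          gcongr
      _ = (1 - η) * D := by field_simp
  have hpt (β : Fin N → Fin m → Fin n) :
      (if D < #(pairBlocks β x y) then (#(pairBlocks β x y) : ℝ) else 0) ≤
        ((#(pairBlocks β x y) : ℝ) - l) ^ 2 / (η ^ 2 * D) := by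
    split_ifs with h
    · rw [le_div_iff₀ (by positivity)]
      set d : ℝ := (#(pairBlocks β x y) : ℝ)
      have h1 : η * d ≤ d - l := by nlinarith
      have h2 : η * D ≤ d - l := by nlinarith
      calc d * (η ^ 2 * D) = (η * d) * (η * D) := by ring
        _ ≤ (d - l) * (d - l) := by
          refine mul_le_mul h1 h2 (by positivity) (le_trans (by positivity) h2)
        _ = _ := by ring
    · positivity
  calc _ ≤ ∑ β : Fin N → Fin m → Fin n, ((#(pairBlocks β x y) : ℝ) - l) ^ 2 / (η ^ 2 * D) :=
        sum_le_sum fun β _ => hpt β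
    _ = (∑ β : Fin N → Fin m → Fin n, ((#(pairBlocks β x y) : ℝ) - l) ^ 2) / (η ^ 2 * D) := by
        rw [sum_div]
    _ ≤ ((n ^ m : ℝ) ^ N * ((1 - η) * D)) / (η ^ 2 * D) := by
        gcongr
        exact hvar.trans (by gcongr)
    _ = (n ^ m : ℝ) ^ N * ((1 - η) / η ^ 2) := by field_simp
    _ ≤ _ := by
        gcongr
        linarith

end RandomBlocks

section SparseBlocks

variable {N m n : ℕ}

/-- Index sets of size between `3` and `k` whose blocks span few vertices. -/
def tightSets (β : Fin N → Fin m → Fin n) (k : ℕ) : Finset (Finset (Fin N)) :=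
  univ.filter fun X => 3 ≤ #X ∧ #X ≤ k ∧ #(blockSpan β X) ≤ (m - 2) * #X + 2

/-- Upper bound for the number of blocks deleted from a random family of blocks. -/
noncomputable def deletionCost (β : Fin N → Fin m → Fin n) (k S : ℕ) (D C : ℝ) : ℝ :=
  ∑ s ∈ Icc 1 S, (s : ℝ) * #(denseSets β s ((m - 2) * s + 1)) +
    (∑ X ∈ tightSets β k, (#X : ℝ) * (1 / D) ^ (#X - 1)) / C +
    ∑ x, ∑ y, if x ≠ y then (if D < #(pairBlocks β x y) then (#(pairBlocks β x y) : ℝ) else 0)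
      else 0

lemma exists_good_blocks (β : Fin N → Fin m → Fin n) (k S : ℕ) {D C : ℝ} (hD : 0 < D)
    (hC : 0 < C) :
    ∃ B : Finset (Fin N), (∀ X ⊆ B, X.Nonempty → #X ≤ S → (m - 2) * #X + 2 ≤ #(blockSpan β X)) ∧
      (∀ x y, x ≠ y → (#(B ∩ pairBlocks β x y) : ℝ) ≤ D) ∧
      (∀ b ∈ B, ∑ X ∈ tightSets β k with b ∈ X, (1 / D) ^ (#X - 1) ≤ C) ∧
      N - deletionCost β k S D C ≤ #B := by
  classical
  set w : Fin N → ℝ := fun b => ∑ X ∈ tightSets β k with b ∈ X, (1 / D) ^ (#X - 1) with hw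
  set b1 : Finset (Fin N) :=
    (Icc 1 S).biUnion fun s => (denseSets β s ((m - 2) * s + 1)).biUnion id with hb1
  set b2 : Finset (Fin N) := univ.filter fun b => C < w b with hb2
  set b3 : Finset (Fin N) := (univ : Finset (Fin n)).biUnion fun x => univ.biUnion fun y =>
    if x ≠ y then (if D < #(pairBlocks β x y) then pairBlocks β x y else ∅) else ∅ with hb3
  refine ⟨(b1 ∪ b2 ∪ b3)ᶜ, ?_, ?_, ?_, ?_⟩
  · intro X hX hne hXS
    by_contra! h
    obtain ⟨b, hb⟩ := hne
    have := hX hb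
    simp only [mem_compl, mem_union, not_or] at this
    refine this.1.1 ?_
    simp only [hb1, mem_biUnion, mem_Icc, denseSets, mem_filter, mem_powersetCard, id]
    exact ⟨#X, ⟨card_pos.2 ⟨b, hb⟩, hXS⟩, X, ⟨⟨subset_univ _, rfl⟩, by omega⟩, hb⟩
  · intro x y hxy
    by_cases h : D < #(pairBlocks β x y)
    · have h0 : (b1 ∪ b2 ∪ b3)ᶜ ∩ pairBlocks β x y = ∅ := by
        refine eq_empty_of_forall_notMem fun b hb => ?_
        simp only [mem_inter, mem_compl, mem_union, not_or] at hb
        refine hb.1.2 ?_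
        simp only [hb3, mem_biUnion, mem_univ, true_and]
        refine ⟨x, y, ?_⟩
        rw [if_pos hxy, if_pos h]
        exact hb.2
      rw [h0]
      simpa using hD.le
    · refine le_trans ?_ (not_lt.1 h)
      exact_mod_cast card_le_card inter_subset_right
  · intro b hb
    simp only [mem_compl, mem_union, not_or] at hb
    have h := hb.1.2
    simp only [hb2, mem_filter, mem_univ, true_and, not_lt] at h
    exact h
  · have h1 : (#b1 : ℝ) ≤ ∑ s ∈ Icc 1 S, (s : ℝ) * #(denseSets β s ((m - 2) * s + 1)) := by
      have : #b1 ≤ ∑ s ∈ Icc 1 S, s * #(denseSets β s ((m - 2) * s + 1)) := by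
        refine card_biUnion_le.trans (sum_le_sum fun s _ => card_biUnion_le.trans ?_)
        have h := sum_le_card_nsmul (denseSets β s ((m - 2) * s + 1)) (fun I => #I) s ?_
        · simpa [mul_comm] using h
        intro I hI
        exact (mem_powersetCard.1 (mem_filter.1 hI).1).2.le
      exact_mod_cast this
    have h2 : (#b2 : ℝ) ≤ (∑ X ∈ tightSets β k, (#X : ℝ) * (1 / D) ^ (#X - 1)) / C := by
      rw [le_div_iff₀ hC]
      have h3 : ∑ b, w b = ∑ X ∈ tightSets β k, (#X : ℝ) * (1 / D) ^ (#X - 1) := by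
        simp only [hw, sum_filter]
        rw [sum_comm]
        refine sum_congr rfl fun X _ => ?_
        rw [← sum_filter, filter_mem_eq_inter, univ_inter, sum_const, nsmul_eq_mul]
      rw [← h3, ← nsmul_eq_mul]
      refine (card_nsmul_le_sum b2 w C fun b hb => (mem_filter.1 hb).2.le).trans ?_
      exact sum_le_sum_of_subset_of_nonneg (subset_univ _) fun b _ _ =>
        sum_nonneg fun X _ => by positivity
    have h3 : (#b3 : ℝ) ≤ ∑ x, ∑ y, if x ≠ y then
        (if D < #(pairBlocks β x y) then (#(pairBlocks β x y) : ℝ) else 0) else 0 := by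
      have : (#b3 : ℝ) ≤ ∑ x, ∑ y, ((#(if x ≠ y then
          (if D < #(pairBlocks β x y) then pairBlocks β x y else ∅) else ∅) : ℕ) : ℝ) := by
        exact_mod_cast card_biUnion_le.trans (sum_le_sum fun x _ => card_biUnion_le)
      refine this.trans (le_of_eq ?_)
      refine sum_congr rfl fun x _ => sum_congr rfl fun y _ => ?_
      split_ifs <;> simp
    have h4 : N ≤ #(b1 ∪ b2 ∪ b3)ᶜ + (#b1 + #b2 + #b3) := by
      have := card_compl_add_card (b1 ∪ b2 ∪ b3)
      rw [Fintype.card_fin] at this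
      have h5 := card_union_le (b1 ∪ b2) b3
      have h6 := card_union_le b1 b2
      omega
    have h5 : (N : ℝ) ≤ #(b1 ∪ b2 ∪ b3)ᶜ + (#b1 + #b2 + #b3) := by exact_mod_cast h4
    rw [deletionCost]
    linarith

lemma sum_tightSets (β : Fin N → Fin m → Fin n) (k : ℕ) (D : ℝ) :
    ∑ X ∈ tightSets β k, (#X : ℝ) * (1 / D) ^ (#X - 1) =
      ∑ j ∈ Icc 3 k, (j : ℝ) * (1 / D) ^ (j - 1) * #(denseSets β j ((m - 2) * j + 2)) := by
  rw [← sum_fiberwise_of_maps_to (s := tightSets β k) (t := Icc 3 k) (g := card)]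
  · refine sum_congr rfl fun j hj => ?_
    have h1 : (tightSets β k).filter (fun X => #X = j) = denseSets β j ((m - 2) * j + 2) := by
      ext X
      simp only [tightSets, denseSets, mem_filter, mem_univ, true_and, mem_powersetCard,
        subset_univ]
      rw [mem_Icc] at hj
      constructor
      · rintro ⟨⟨-, -, h⟩, rfl⟩
        exact ⟨rfl, h⟩
      · rintro ⟨rfl, h⟩
        exact ⟨⟨hj.1, hj.2, h⟩, rfl⟩
    have h2 : ∀ X ∈ denseSets β j ((m - 2) * j + 2),
        (#X : ℝ) * (1 / D) ^ (#X - 1) = (j : ℝ) * (1 / D) ^ (j - 1) := by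
      intro X hX
      rw [(mem_powersetCard.1 (mem_filter.1 hX).1).2]
    rw [h1, sum_congr rfl h2, sum_const, nsmul_eq_mul, mul_comm]
  · intro X hX
    simp only [tightSets, mem_filter, mem_univ, true_and] at hX
    exact mem_Icc.2 ⟨hX.1, hX.2.1⟩

lemma exists_deletionCost_le (hn : 0 < n) (hm : 2 ≤ m) (k S : ℕ) {D C η : ℝ} (hD : 0 < D)
    (hC : 0 < C) (hη0 : 0 < η) (hη1 : η < 1) (hN : (N : ℝ) ≤ (1 - η) * D * n ^ 2 / m ^ 2)
    (hS : (m - 2) * S + 1 ≤ n) (hk : (m - 2) * k + 2 ≤ n) :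
    ∃ β : Fin N → Fin m → Fin n, deletionCost β k S D C ≤
      (∑ s ∈ Icc 1 S, (s : ℝ) * (D ^ s * ((((m - 2) * s + 1 : ℕ) : ℝ) ^ m) ^ s)) * n +
      (∑ j ∈ Icc 3 k, (j : ℝ) * ((((m - 2) * j + 2 : ℕ) : ℝ) ^ m) ^ j) * D * n ^ 2 / C +
      n ^ 2 / η ^ 2 := by
  have : Nonempty (Fin n) := ⟨⟨0, hn⟩⟩
  have hN' : (N : ℝ) ≤ D * n ^ 2 := by
    refine hN.trans ?_
    have hm1 : (1 : ℝ) ≤ m ^ 2 := one_le_pow₀ (by exact_mod_cast (by omega : 1 ≤ m))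
    rw [div_le_iff₀ (by linarith)]
    have h2 : 0 ≤ D * (n : ℝ) ^ 2 := by positivity
    nlinarith
  set P : ℝ := (n ^ m : ℝ) ^ N with hP
  suffices h : ∑ β : Fin N → Fin m → Fin n, deletionCost β k S D C ≤
      ∑ _β : Fin N → Fin m → Fin n,
      ((∑ s ∈ Icc 1 S, (s : ℝ) * (D ^ s * ((((m - 2) * s + 1 : ℕ) : ℝ) ^ m) ^ s)) * n +
      (∑ j ∈ Icc 3 k, (j : ℝ) * ((((m - 2) * j + 2 : ℕ) : ℝ) ^ m) ^ j) * D * n ^ 2 / C +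
      n ^ 2 / η ^ 2) by
    obtain ⟨β, -, hβ⟩ := exists_le_of_sum_le univ_nonempty h
    exact ⟨β, hβ⟩
  have h1 : ∑ β : Fin N → Fin m → Fin n,
      ∑ s ∈ Icc 1 S, (s : ℝ) * #(denseSets β s ((m - 2) * s + 1)) ≤
      P * ((∑ s ∈ Icc 1 S, (s : ℝ) * (D ^ s * ((((m - 2) * s + 1 : ℕ) : ℝ) ^ m) ^ s)) * n) := by
    rw [sum_comm, sum_mul, mul_sum]
    refine sum_le_sum fun s hs => ?_
    rw [← mul_sum]
    have h := sum_card_denseSets_le (N := N) (r := 1) hn hm hN'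
      (le_trans (Nat.add_le_add_right (Nat.mul_le_mul_left _ (mem_Icc.1 hs).2) _) hS)
    calc _ ≤ (s : ℝ) * _ := mul_le_mul_of_nonneg_left h (by positivity)
      _ = _ := by rw [pow_one]; ring
  have h2 : ∑ β : Fin N → Fin m → Fin n,
      ∑ X ∈ tightSets β k, (#X : ℝ) * (1 / D) ^ (#X - 1) ≤
      P * ((∑ j ∈ Icc 3 k, (j : ℝ) * ((((m - 2) * j + 2 : ℕ) : ℝ) ^ m) ^ j) * D * n ^ 2) := by
    simp only [sum_tightSets]
    rw [sum_comm, sum_mul, sum_mul, mul_sum]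
    refine sum_le_sum fun j hj => ?_
    rw [← mul_sum]
    have h := sum_card_denseSets_le (N := N) (r := 2) hn hm hN'
      (le_trans (Nat.add_le_add_right (Nat.mul_le_mul_left _ (mem_Icc.1 hj).2) _) hk)
    calc _ ≤ (j : ℝ) * (1 / D) ^ (j - 1) * _ := mul_le_mul_of_nonneg_left h (by positivity)
      _ = _ := by
        obtain ⟨i, rfl⟩ := Nat.exists_eq_add_of_le (mem_Icc.1 hj).1
        have : (1 / D) ^ (3 + i - 1) * D ^ (3 + i) = D := by
          rw [show 3 + i - 1 = i + 2 by omega, one_div, inv_pow, show 3 + i = (i + 2) + 1 by omega,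
            pow_succ D (i + 2), ← mul_assoc, inv_mul_cancel₀ (by positivity), one_mul]
        linear_combination (((3 + i : ℕ) : ℝ) * P *
          ((((m - 2) * (3 + i) + 2 : ℕ) : ℝ) ^ m) ^ (3 + i) * n ^ 2) * this
  have h3 : ∑ β : Fin N → Fin m → Fin n, (∑ x, ∑ y, if x ≠ y then
      (if D < #(pairBlocks β x y) then (#(pairBlocks β x y) : ℝ) else 0) else 0) ≤
      P * (n ^ 2 / η ^ 2) := by
    rw [sum_comm]
    calc _ ≤ ∑ x : Fin n, ∑ y : Fin n, P * (1 / η ^ 2) := by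
          refine sum_le_sum fun x _ => ?_
          rw [sum_comm]
          refine sum_le_sum fun y _ => ?_
          by_cases hxy : x = y
          · simp only [hxy, ne_eq, not_true_eq_false, if_false, sum_const_zero]
            positivity
          · simp only [ne_eq, hxy, not_false_eq_true, if_true]
            exact sum_pairBlocks_excess_le hn hxy hD hη0 hη1 (by omega) hN
      _ = _ := by
        simp only [sum_const, card_univ, Fintype.card_fin, nsmul_eq_mul]
        ring
  have hcard : ((#(univ : Finset (Fin N → Fin m → Fin n)) : ℕ) : ℝ) = P := by
    simp [hP]
  rw [sum_const, nsmul_eq_mul, hcard]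
  simp only [deletionCost, sum_add_distrib]
  rw [← sum_div, mul_add, mul_add, mul_div_assoc' P]
  gcongr

/-- Families of `m`-sets on `n` vertices that nearly form a `D`-fold cover of the pairs and are
locally sparse. -/
theorem exists_sparse_blocks {m : ℕ} (hm : 2 ≤ m) (k : ℕ) {η : ℝ} (hη0 : 0 < η) (hη1 : η < 1) :
    ∃ C D₀ : ℝ, ∀ D : ℝ, D₀ ≤ D → ∀ S : ℕ, ∃ n₀ : ℕ, ∀ n, n₀ ≤ n →
      ∃ (N : ℕ) (β : Fin N → Fin m → Fin n) (B : Finset (Fin N)),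
      (∀ X ⊆ B, X.Nonempty → #X ≤ S → (m - 2) * #X + 2 ≤ #(blockSpan β X)) ∧
      (∀ x y, x ≠ y → (#(B ∩ pairBlocks β x y) : ℝ) ≤ D) ∧
      (∀ b ∈ B, ∑ X ∈ tightSets β k with b ∈ X, (1 / D) ^ (#X - 1) ≤ C) ∧
      (1 - η) * D * n ^ 2 / m ^ 2 ≤ #B := by
  have hm0 : (0 : ℝ) < m := by exact_mod_cast (by omega : 0 < m)
  set c2 : ℝ := ∑ j ∈ Icc 3 k, (j : ℝ) * ((((m - 2) * j + 2 : ℕ) : ℝ) ^ m) ^ j with hc2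
  have hc20 : 0 ≤ c2 := sum_nonneg fun j _ => by positivity
  refine ⟨6 * m ^ 2 * (c2 + 1) / η, max 1 (24 * m ^ 2 / η ^ 3), fun D hD S => ?_⟩
  have hD1 : 1 ≤ D := (le_max_left _ _).trans hD
  have hD24 : 24 * m ^ 2 / η ^ 3 ≤ D := (le_max_right _ _).trans hD
  have hD0 : 0 < D := by linarith
  set C := 6 * m ^ 2 * (c2 + 1) / η with hC
  have hC0 : 0 < C := by positivity
  set c1 : ℝ := ∑ s ∈ Icc 1 S, (s : ℝ) * (D ^ s * ((((m - 2) * s + 1 : ℕ) : ℝ) ^ m) ^ s) with hc1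
  have hc10 : 0 ≤ c1 := sum_nonneg fun j _ => by positivity
  obtain ⟨n₁, hn₁⟩ := exists_nat_ge ((c1 + 1) * (6 * m ^ 2 / (η * D)))
  refine ⟨max (max 1 n₁) (max ((m - 2) * S + 1) ((m - 2) * k + 2)), fun n hn => ?_⟩
  simp only [max_le_iff] at hn
  obtain ⟨⟨hn0, hnn₁⟩, hnS, hnk⟩ := hn
  have hn1 : (1 : ℝ) ≤ n := by exact_mod_cast hn0
  have hnbig : (c1 + 1) * (6 * m ^ 2 / (η * D)) ≤ n := hn₁.trans (by exact_mod_cast hnn₁)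
  set A := D * n ^ 2 / m ^ 2 with hA
  have hA0 : 0 ≤ A := by positivity
  set N := ⌊(1 - η / 2) * A⌋₊ with hN
  have hNle : (N : ℝ) ≤ (1 - η / 2) * D * n ^ 2 / m ^ 2 := by
    calc (N : ℝ) ≤ (1 - η / 2) * A := Nat.floor_le (mul_nonneg (by linarith) hA0)
      _ = _ := by rw [hA]; ring
  have hNge : (1 - η / 2) * A - 1 ≤ N := (Nat.sub_one_lt_floor _).le
  obtain ⟨β, hβ⟩ := exists_deletionCost_le (N := N) (m := m) (n := n) hn0 hm k S hD0 hC0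
    (half_pos hη0) (by linarith) hNle hnS hnk
  obtain ⟨B, hB1, hB2, hB3, hB4⟩ := exists_good_blocks β k S hD0 hC0
  refine ⟨N, β, B, hB1, hB2, hB3, le_trans ?_ hB4⟩
  have e1 : c1 * n + 1 ≤ η / 6 * A := by
    have h1 : (c1 + 1) * 6 * m ^ 2 ≤ n * (η * D) := by
      have := mul_le_mul_of_nonneg_right hnbig (show 0 ≤ η * D by positivity)
      have h2 : (c1 + 1) * (6 * m ^ 2 / (η * D)) * (η * D) = (c1 + 1) * 6 * m ^ 2 := by
        field_simp
      linarith
    have h3 : c1 * n + 1 ≤ (c1 + 1) * n := by linarith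
    refine h3.trans ?_
    have h4 : η / 6 * A = n * (n * (η * D)) / (6 * m ^ 2) := by rw [hA]; field_simp
    rw [h4, le_div_iff₀ (by positivity)]
    have := mul_le_mul_of_nonneg_left h1 (show (0 : ℝ) ≤ n by linarith)
    linarith
  have e2 : c2 * D * n ^ 2 / C ≤ η / 6 * A := by
    have h4 : c2 * D * n ^ 2 / C = (c2 / (c2 + 1)) * (η / 6 * A) := by
      rw [hC, hA]; field_simp
    rw [h4]
    refine mul_le_of_le_one_left (by positivity) ?_
    rw [div_le_one (by positivity)]
    linarith
  have e3 : n ^ 2 / (η / 2) ^ 2 ≤ η / 6 * A := by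
    have h4 : η / 6 * A = (n ^ 2 / (η / 2) ^ 2) * (D / (24 * m ^ 2 / η ^ 3)) := by
      rw [hA]; field_simp; ring
    rw [h4]
    refine le_mul_of_one_le_right (by positivity) ?_
    rw [one_le_div (by positivity)]
    exact hD24
  have e4 : (1 - η) * D * n ^ 2 / m ^ 2 = (1 - η) * A := by rw [hA]; ring
  rw [e4]
  linarith

end SparseBlocks

section TightSystems

variable {ι α : Type*} [DecidableEq ι] [DecidableEq α] {V : ι → Finset α} {B : Finset ι} {g S : ℕ}

/-- A set of indices from `B` spanning exactly `g * #X + 2` points. -/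
def IsTight (V : ι → Finset α) (B : Finset ι) (g : ℕ) (X : Finset ι) : Prop :=
  X ⊆ B ∧ #(X.biUnion V) = g * #X + 2

lemma IsTight.union_inter
    (hB : ∀ X ⊆ B, X.Nonempty → #X ≤ S → g * #X + 2 ≤ #(X.biUnion V)) {X Y : Finset ι}
    (hX : IsTight V B g X) (hY : IsTight V B g Y) (hXY : (X ∩ Y).Nonempty) (hS : #(X ∪ Y) ≤ S) :
    IsTight V B g (X ∪ Y) ∧ IsTight V B g (X ∩ Y) ∧
      X.biUnion V ∩ Y.biUnion V = (X ∩ Y).biUnion V := by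
  have hXYB : X ∪ Y ⊆ B := union_subset hX.1 hY.1
  have hinB : X ∩ Y ⊆ B := inter_subset_left.trans hX.1
  have h1 := hB _ hXYB (hXY.mono (inter_subset_left.trans subset_union_left)) hS
  have h2 := hB _ hinB hXY
    ((card_le_card (inter_subset_left.trans subset_union_left)).trans hS)
  have hsub : (X ∩ Y).biUnion V ⊆ X.biUnion V ∩ Y.biUnion V :=
    subset_inter (biUnion_subset_biUnion_of_subset_left _ inter_subset_left)
      (biUnion_subset_biUnion_of_subset_left _ inter_subset_right)
  have hun : (X ∪ Y).biUnion V = X.biUnion V ∪ Y.biUnion V := union_biUnion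
  have h3 := card_union_add_card_inter (X.biUnion V) (Y.biUnion V)
  have h4 := card_union_add_card_inter X Y
  have h5 := card_le_card hsub
  rw [← hun, hX.2, hY.2] at h3
  have h6 : g * #(X ∪ Y) + g * #(X ∩ Y) = g * #X + g * #Y := by
    rw [← mul_add, h4, mul_add]
  refine ⟨⟨hXYB, by omega⟩, ⟨hinB, by omega⟩, ?_⟩
  exact (eq_of_subset_of_card_le hsub (by omega)).symm

variable [Fintype ι]

/-- The minimal tight sets with between `2` and `k` elements. -/
def tightConflicts (V : ι → Finset α) (B : Finset ι) (g k : ℕ) : Finset (Finset ι) :=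
  univ.filter fun X => X ⊆ B ∧ 2 ≤ #X ∧ #X ≤ k ∧ #(X.biUnion V) = g * #X + 2 ∧
    ∀ Y ∈ X.powerset, 2 ≤ #Y → #(Y.biUnion V) = g * #Y + 2 → Y = X

variable {k : ℕ}

lemma mem_tightConflicts {X : Finset ι} : X ∈ tightConflicts V B g k ↔
    IsTight V B g X ∧ 2 ≤ #X ∧ #X ≤ k ∧ ∀ Y ⊆ X, 2 ≤ #Y → IsTight V B g Y → Y = X := by
  simp only [tightConflicts, mem_filter, mem_univ, true_and, mem_powerset, IsTight]
  constructor
  · rintro ⟨h1, h2, h3, h4, h5⟩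
    exact ⟨⟨h1, h4⟩, h2, h3, fun Y hY hY2 hYt => h5 Y hY hY2 hYt.2⟩
  · rintro ⟨⟨h1, h4⟩, h2, h3, h5⟩
    exact ⟨h1, h2, h3, h4, fun Y hY hY2 hYt => h5 Y hY hY2 ⟨hY.trans h1, hYt⟩⟩

lemma isTight_singleton (hV : ∀ b, #(V b) ≤ g + 2) (hS : 1 ≤ S)
    (hB : ∀ X ⊆ B, X.Nonempty → #X ≤ S → g * #X + 2 ≤ #(X.biUnion V)) {b : ι} (hb : b ∈ B) :
    IsTight V B g {b} := by
  have h := hB {b} (by simpa using hb) (singleton_nonempty b) (by simpa using hS)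
  have := hV b
  refine ⟨by simpa using hb, ?_⟩
  simp only [card_singleton, singleton_biUnion] at h ⊢
  omega

lemma exists_isTight_of_mem_conflictBall (hV : ∀ b, #(V b) ≤ g + 2)
    (hB : ∀ X ⊆ B, X.Nonempty → #X ≤ S → g * #X + 2 ≤ #(X.biUnion V)) {b : ι} {t : ℕ}
    (hS : 1 + t * k ≤ S) {c z : ι} (hc : c ∈ B) (hcb : c ≠ b)
    (hz : z ∈ conflictBall (tightConflicts V B g k) (univ.erase b) t c) :
    ∃ Y, IsTight V B g Y ∧ b ∉ Y ∧ c ∈ Y ∧ z ∈ Y ∧ #Y ≤ 1 + t * k := by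
  induction t generalizing c with
  | zero =>
    obtain rfl : z = c := hz
    exact ⟨{z}, isTight_singleton hV (by omega) hB hc, by simpa using hcb.symm, by simp, by simp,
      by simp⟩
  | succ t ih =>
    rw [Nat.succ_mul] at hS ⊢
    rcases hz with hz | ⟨X, hX, hcX, hXb, c', hc', hz⟩
    · obtain ⟨Y, h1, h2, h3, h4, h5⟩ := ih (by omega) hc hcb hz
      exact ⟨Y, h1, h2, h3, h4, by omega⟩
    · obtain ⟨hXt, -, hXk, -⟩ := mem_tightConflicts.1 hX
      obtain ⟨Y, h1, h2, h3, h4, h5⟩ := ih (by omega) (hXt.1 hc')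
        (ne_of_mem_erase (hXb hc')) hz
      have h6 := card_union_le X Y
      refine ⟨X ∪ Y, (hXt.union_inter hB h1 ⟨c', mem_inter.2 ⟨hc', h3⟩⟩ (by omega)).1, ?_,
        mem_union_left _ hcX, mem_union_right _ h4, by omega⟩
      rw [mem_union, not_or]
      exact ⟨fun h => ne_of_mem_erase (hXb h) rfl, h2⟩

/-- If a tight set avoiding `b` meets two different conflicts through `b`, then the conflicts are
pairs whose blocks meet the block of `b` in the same points. -/
lemma tightConflicts_separated
    (hB : ∀ X ⊆ B, X.Nonempty → #X ≤ S → g * #X + 2 ≤ #(X.biUnion V)) {b c c' : ι}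
    {X X' Y : Finset ι} (hX : X ∈ tightConflicts V B g k) (hX' : X' ∈ tightConflicts V B g k)
    (hY : IsTight V B g Y) (hS : k + (k + #Y) ≤ S) (hbX : b ∈ X) (hbX' : b ∈ X') (hbY : b ∉ Y)
    (hcX : c ∈ X) (hcX' : c' ∈ X') (hcY : c ∈ Y) (hcY' : c' ∈ Y) :
    (c = c' ∧ X = X') ∨ (X = {b, c} ∧ V b ∩ V c' ⊆ V b ∩ V c) := by
  obtain ⟨hXt, hX2, hXk, hXmin⟩ := mem_tightConflicts.1 hX
  obtain ⟨hXt', hX2', hXk', hXmin'⟩ := mem_tightConflicts.1 hX'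
  have key : ∀ {Z : Finset ι} {d : ι}, IsTight V B g Z → #Z ≤ k →
      (∀ Y ⊆ Z, 2 ≤ #Y → IsTight V B g Y → Y = Z) → b ∈ Z → d ∈ Z → d ∈ Y → Z ∩ Y = {d} := by
    intro Z d hZ hZk hmin hbZ hdZ hdY
    have h1 := card_union_le Z Y
    obtain ⟨-, h2, -⟩ := hZ.union_inter hB hY ⟨d, mem_inter.2 ⟨hdZ, hdY⟩⟩ (by omega)
    have h3 : ¬ 2 ≤ #(Z ∩ Y) := by
      intro h
      have h4 := hmin _ inter_subset_left h h2
      exact hbY (mem_inter.1 (h4 ▸ hbZ)).2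
    obtain ⟨e, he⟩ := card_eq_one.1 (le_antisymm (by omega : #(Z ∩ Y) ≤ 1)
      (card_pos.2 ⟨d, mem_inter.2 ⟨hdZ, hdY⟩⟩))
    have h5 : d ∈ Z ∩ Y := mem_inter.2 ⟨hdZ, hdY⟩
    rw [he, mem_singleton] at h5
    rw [he, h5]
  have hXY := key hXt hXk hXmin hbX hcX hcY
  have hXY' := key hXt' hXk' hXmin' hbX' hcX' hcY'
  by_cases hXX : X = X'
  · left
    refine ⟨?_, hXX⟩
    subst hXX
    rw [hXY] at hXY'
    simpa using hXY'
  right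
  have hu := card_union_le X X'
  have huY := card_union_le X' Y
  have huY2 := card_union_le X (X' ∪ Y)
  have hb : b ∈ X ∩ X' := mem_inter.2 ⟨hbX, hbX'⟩
  have h_int : X ∩ X' = {b} := by
    obtain ⟨-, h2, -⟩ := hXt.union_inter hB hXt' ⟨b, hb⟩ (by omega)
    have h3 : ¬ 2 ≤ #(X ∩ X') := by
      intro h
      exact hXX ((hXmin _ inter_subset_left h h2).symm.trans
        (hXmin' _ inter_subset_right h h2))
    obtain ⟨e, he⟩ := card_eq_one.1 (le_antisymm (by omega : #(X ∩ X') ≤ 1) (card_pos.2 ⟨b, hb⟩))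
    have h5 := hb
    rw [he, mem_singleton] at h5
    rw [he, h5]
  have hcb : c ≠ b := fun h => hbY (h ▸ hcY)
  constructor
  · obtain ⟨hun, -, -⟩ := hXt'.union_inter hB hY ⟨c', mem_inter.2 ⟨hcX', hcY'⟩⟩ (by omega)
    have hb2 : b ∈ X ∩ (X' ∪ Y) := mem_inter.2 ⟨hbX, mem_union_left _ hbX'⟩
    have hc2 : c ∈ X ∩ (X' ∪ Y) := mem_inter.2 ⟨hcX, mem_union_right _ hcY⟩
    obtain ⟨-, h2, -⟩ := hXt.union_inter hB hun ⟨b, hb2⟩ (by omega)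
    have h3 := hXmin _ inter_subset_left (one_lt_card.2 ⟨b, hb2, c, hc2, hcb.symm⟩) h2
    rw [inter_union_distrib_left, h_int, hXY] at h3
    rw [← h3]
    rfl
  · have h1 := card_union_le X Y
    obtain ⟨-, -, h2⟩ := hXt.union_inter hB hY ⟨c, mem_inter.2 ⟨hcX, hcY⟩⟩ (by omega)
    rw [hXY, singleton_biUnion] at h2
    intro x hx
    rw [mem_inter] at hx ⊢
    refine ⟨hx.1, ?_⟩
    rw [← h2, mem_inter]
    exact ⟨mem_biUnion.2 ⟨b, hbX, hx.1⟩, mem_biUnion.2 ⟨c', hcY', hx.2⟩⟩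

lemma card_inter_of_isTight_pair (hV : ∀ b, #(V b) ≤ g + 2) (hS : 1 ≤ S)
    (hB : ∀ X ⊆ B, X.Nonempty → #X ≤ S → g * #X + 2 ≤ #(X.biUnion V)) {b c : ι} (hcb : c ≠ b)
    (h : IsTight V B g {b, c}) : #(V b ∩ V c) = 2 := by
  have h1 := (isTight_singleton hV hS hB (h.1 (mem_insert_self b _))).2
  have h2 := (isTight_singleton hV hS hB (h.1 (mem_insert_of_mem (mem_singleton_self c)))).2
  have h3 := h.2
  have h4 := card_union_add_card_inter (V b) (V c)
  simp only [card_singleton, singleton_biUnion, biUnion_insert, card_pair hcb.symm] at h1 h2 h3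
  omega

lemma lt_card_biUnion_of_conflict_free (hkS : k ≤ S)
    (hB : ∀ X ⊆ B, X.Nonempty → #X ≤ S → g * #X + 2 ≤ #(X.biUnion V)) {M : Finset ι} (hM : M ⊆ B)
    (hfree : ∀ X ∈ tightConflicts V B g k, ¬ X ⊆ M) {J : Finset ι} (hJ : J ⊆ M) (hJ2 : 2 ≤ #J)
    (hJk : #J ≤ k) : g * #J + 3 ≤ #(J.biUnion V) := by
  by_contra hlt
  have hJne : J.Nonempty := card_pos.1 (by omega)
  have h1 := hB J (hJ.trans hM) hJne (by omega)
  have hJt : IsTight V B g J := ⟨hJ.trans hM, by omega⟩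
  classical
  obtain ⟨X, hX, hXmin⟩ := exists_min_image (J.powerset.filter fun Y => 2 ≤ #Y ∧
    #(Y.biUnion V) = g * #Y + 2) card
    ⟨J, by simp only [mem_filter, mem_powerset]; exact ⟨Subset.rfl, hJ2, hJt.2⟩⟩
  simp only [mem_filter, mem_powerset] at hX hXmin
  refine hfree X (mem_tightConflicts.2 ⟨⟨hX.1.trans (hJ.trans hM), hX.2.2⟩, hX.2.1,
    (card_le_card hX.1).trans hJk, fun Y hY hY2 hYt => ?_⟩) (hX.1.trans hJ)
  exact eq_of_subset_of_card_le hY (hXmin Y ⟨hY.trans hX.1, hY2, hYt.2⟩)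

end TightSystems

/-- Nearly perfect packings of `m`-sets in which any `j ≤ k` blocks with `j ≥ 2` span at least
`(m - 2) * j + 3` vertices. -/
theorem exists_packing {m : ℕ} (hm : 2 ≤ m) (k : ℕ) {ε : ℝ} (hε0 : 0 < ε) (hε1 : ε < 1) :
    ∃ n₀ : ℕ, ∀ n, n₀ ≤ n → ∃ (N : ℕ) (β : Fin N → Fin m → Fin n) (M : Finset (Fin N)),
      (∀ b ∈ M, #(univ.image (β b)) = m) ∧
      (∀ J ⊆ M, 2 ≤ #J → #J ≤ k → (m - 2) * #J + 3 ≤ #(blockSpan β J)) ∧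
      (1 - ε) ^ 2 * n ^ 2 / m ^ 2 ≤ #M := by
  obtain ⟨C, D₀, hhost⟩ := exists_sparse_blocks hm k hε0 hε1
  obtain ⟨T, D₁, hnibble⟩ := exists_conflict_free (2 ^ m) (C := max C 0) hε0 hε1
  set D := max 1 (max D₀ D₁) with hD
  have hD0 : 0 < D := lt_of_lt_of_le one_pos (le_max_left _ _)
  set S := k + (k + 2 * (1 + T * k)) with hS
  obtain ⟨n₀, hn₀⟩ := hhost D ((le_max_left _ _).trans (le_max_right _ _)) S
  refine ⟨n₀, fun n hn => ?_⟩
  obtain ⟨N, β, B, hB, hpair, hweight, hcard⟩ := hn₀ n hn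
  set V : Fin N → Finset (Fin n) := fun b => univ.image (β b) with hV
  have hVm : ∀ b, #(V b) ≤ (m - 2) + 2 := by
    intro b
    have : #(V b) ≤ m := by simpa using card_image_le (s := univ) (f := β b)
    omega
  have hS1 : 1 ≤ S := by omega
  have hB' : ∀ X ⊆ B, X.Nonempty → #X ≤ S → (m - 2) * #X + 2 ≤ #(X.biUnion V) := hB
  have hpack : ∃ M ⊆ B, (∀ X ∈ tightConflicts V B (m - 2) k, ¬ X ⊆ M) ∧
      (1 - ε) * #B / D ≤ #M := by
    refine hnibble D ((le_max_right _ _).trans (le_max_right _ _)) (Fin N) (Finset (Fin n))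
      (tightConflicts V B (m - 2) k) (fun b c => V b ∩ V c) B
      (fun X hX => (mem_tightConflicts.1 hX).2.1) ?_ ?_ ?_ ?_
    · intro b
      have h1 : (univ.filter fun c => c ≠ b ∧ {b, c} ∈ tightConflicts V B (m - 2) k).image
          (fun c => V b ∩ V c) ⊆ (V b).powerset := by
        intro p hp
        obtain ⟨c, -, rfl⟩ := mem_image.1 hp
        exact mem_powerset.2 inter_subset_left
      refine (card_le_card h1).trans ?_
      rw [card_powerset]
      exact Nat.pow_le_pow_right (by norm_num) (by have := hVm b; omega)
    · intro b p
      rcases (univ.filter fun c => c ≠ b ∧ {b, c} ∈ tightConflicts V B (m - 2) k ∧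
        V b ∩ V c = p).eq_empty_or_nonempty with h | ⟨c₀, hc₀⟩
      · rw [h]
        simpa using hD0.le
      · simp only [mem_filter, mem_univ, true_and] at hc₀
        obtain ⟨hc₀b, hc₀t, rfl⟩ := hc₀
        have h2 := card_inter_of_isTight_pair hVm hS1 hB' hc₀b (mem_tightConflicts.1 hc₀t).1
        obtain ⟨x, y, hxy, hp⟩ := card_eq_two.1 h2
        refine le_trans ?_ (hpair x y hxy)
        refine Nat.cast_le.2 (card_le_card fun c hc => ?_)
        simp only [mem_filter, mem_univ, true_and] at hc
        obtain ⟨hcb, hct, hceq⟩ := hc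
        have hx : x ∈ V b ∩ V c := by rw [hceq, hp]; simp
        have hy : y ∈ V b ∩ V c := by rw [hceq, hp]; simp
        simp only [pairBlocks, mem_inter, mem_filter, mem_univ, true_and]
        exact ⟨(mem_tightConflicts.1 hct).1.1 (by simp), (mem_inter.1 hx).2, (mem_inter.1 hy).2⟩
    · intro b
      by_cases hb : b ∈ B
      · refine le_trans ?_ ((hweight b hb).trans (le_max_left _ _))
        refine sum_le_sum_of_subset_of_nonneg (fun X hX => ?_) fun X _ _ => by positivity
        simp only [mem_filter] at hX
        obtain ⟨hX, hbX, hX3⟩ := hX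
        obtain ⟨hXt, -, hXk, -⟩ := mem_tightConflicts.1 hX
        simp only [tightSets, mem_filter, mem_univ, true_and]
        exact ⟨⟨hX3, hXk, hXt.2.le⟩, hbX⟩
      · rw [filter_false_of_mem]
        · simp
        · rintro X hX ⟨hbX, -⟩
          exact hb ((mem_tightConflicts.1 hX).1.1 hbX)
    · intro b X hX X' hX' hbX hbX' c hc c' hc' hcb hcb' z hz hz'
      have hkS : 1 + T * k ≤ S := by omega
      obtain ⟨Y₁, hY₁, hb₁, hc₁, hz₁, hk₁⟩ := exists_isTight_of_mem_conflictBall hVm hB' hkS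
        ((mem_tightConflicts.1 hX).1.1 hc) hcb hz
      obtain ⟨Y₂, hY₂, hb₂, hc₂, hz₂, hk₂⟩ := exists_isTight_of_mem_conflictBall hVm hB' hkS
        ((mem_tightConflicts.1 hX').1.1 hc') hcb' hz'
      have hYc := card_union_le Y₁ Y₂
      obtain ⟨hY, -, -⟩ := hY₁.union_inter hB' hY₂ ⟨z, mem_inter.2 ⟨hz₁, hz₂⟩⟩ (by omega)
      have hbY : b ∉ Y₁ ∪ Y₂ := by simp [hb₁, hb₂]
      have h1 := tightConflicts_separated hB' hX hX' hY (by omega) hbX hbX' hbY hc hc'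
        (mem_union_left _ hc₁) (mem_union_right _ hc₂)
      have h2 := tightConflicts_separated hB' hX' hX hY (by omega) hbX' hbX hbY hc' hc
        (mem_union_right _ hc₂) (mem_union_left _ hc₁)
      rcases h1 with h1 | ⟨h1, h3⟩
      · exact Or.inl h1
      rcases h2 with h2 | ⟨h2, h4⟩
      · exact Or.inl ⟨h2.1.symm, h2.2.symm⟩
      · right
        refine ⟨?_, ?_, Subset.antisymm h4 h3⟩
        · rw [h1, card_pair hcb.symm]
        · rw [h2, card_pair hcb'.symm]
  obtain ⟨M, hMB, hMfree, hMcard⟩ := hpack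
  refine ⟨N, β, M, ?_, ?_, ?_⟩
  · intro b hb
    have h := (isTight_singleton hVm hS1 hB' (hMB hb)).2
    simp only [singleton_biUnion, card_singleton] at h
    have h2 : #(univ.image (β b)) = (m - 2) * 1 + 2 := h
    omega
  · intro J hJ hJ2 hJk
    exact lt_card_biUnion_of_conflict_free (by omega) hB' hMB hMfree hJ hJ2 hJk
  · refine le_trans ?_ hMcard
    rw [le_div_iff₀ hD0]
    calc (1 - ε) ^ 2 * n ^ 2 / m ^ 2 * D = (1 - ε) * ((1 - ε) * D * n ^ 2 / m ^ 2) := by ring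
      _ ≤ _ := mul_le_mul_of_nonneg_left hcard (by linarith)

section Counting

lemma bddAbove_exNum (r n s k : ℕ) : BddAbove {m : ℕ | ∃ G : Finset (Finset (Fin n)),
    (∀ e ∈ G, e.card = r) ∧ IsFree G s k ∧ G.card = m} := by
  refine ⟨#(univ : Finset (Finset (Fin n))), ?_⟩
  rintro _ ⟨G, -, -, rfl⟩
  exact card_le_univ G

lemma card_le_exNum {r n s k : ℕ} {G : Finset (Finset (Fin n))} (hG : ∀ e ∈ G, e.card = r)
    (hfree : IsFree G s k) : #G ≤ exNum r n s k :=
  le_csSup (bddAbove_exNum r n s k) ⟨G, hG, hfree, rfl⟩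

lemma exists_card_eq_exNum (r n s : ℕ) {k : ℕ} (hk : 0 < k) : ∃ G : Finset (Finset (Fin n)),
    (∀ e ∈ G, e.card = r) ∧ IsFree G s k ∧ #G = exNum r n s k := by
  refine Nat.sSup_mem (s := {m : ℕ | ∃ G : Finset (Finset (Fin n)),
    (∀ e ∈ G, e.card = r) ∧ IsFree G s k ∧ G.card = m}) ⟨0, ∅, by simp, ?_, rfl⟩
    (bddAbove_exNum r n s k)
  rintro ⟨S, hS, hSk, -⟩
  rw [subset_empty.1 hS, card_empty] at hSk
  omega

lemma exNum_le {n k : ℕ} (hk : 0 < k) : exNum 3 n (k + 2) k ≤ n ^ 2 * k := by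
  obtain ⟨G, hG, hfree, hcard⟩ := exists_card_eq_exNum 3 n (k + 2) hk
  rw [← hcard]
  have h1 : G ⊆ (univ : Finset (Fin n × Fin n)).biUnion fun p =>
      G.filter fun e => p.1 ≠ p.2 ∧ p.1 ∈ e ∧ p.2 ∈ e := by
    intro e he
    obtain ⟨x, hx, y, hy, hxy⟩ := one_lt_card.1 (by rw [hG e he]; norm_num : 1 < #e)
    simp only [mem_biUnion, mem_univ, true_and, mem_filter]
    exact ⟨(x, y), he, hxy, hx, hy⟩
  have h2 : ∀ p ∈ (univ : Finset (Fin n × Fin n)),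
      #(G.filter fun e => p.1 ≠ p.2 ∧ p.1 ∈ e ∧ p.2 ∈ e) ≤ k := by
    rintro ⟨x, y⟩ -
    by_contra! hlt
    obtain ⟨S, hS, hSk⟩ := exists_subset_card_eq hlt.le
    refine hfree ⟨S, hS.trans (filter_subset _ _), hSk, ?_⟩
    have h3 : S.sup id ⊆ {x, y} ∪ S.biUnion fun e => (e.erase x).erase y := by
      intro z hz
      obtain ⟨e, he, hze⟩ := mem_sup.1 hz
      rw [id] at hze
      simp only [mem_union, mem_insert, mem_singleton, mem_biUnion, mem_erase]
      by_cases hzx : z = x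
      · exact Or.inl (Or.inl hzx)
      by_cases hzy : z = y
      · exact Or.inl (Or.inr hzy)
      exact Or.inr ⟨e, he, hzy, hzx, hze⟩
    have h4 : #(S.biUnion fun e => (e.erase x).erase y) ≤ #S * 1 := by
      refine card_biUnion_le_card_mul _ _ _ fun e he => ?_
      obtain ⟨heG, hxy, hx, hy⟩ := mem_filter.1 (hS he)
      have hy' : y ∈ e.erase x := mem_erase.2 ⟨fun h => hxy h.symm, hy⟩
      rw [card_erase_of_mem hy', card_erase_of_mem hx, hG e heG]
    have h5 := card_le_card h3
    have h6 := card_union_le ({x, y} : Finset (Fin n)) (S.biUnion fun e => (e.erase x).erase y)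
    have h7 := card_le_two (a := x) (b := y)
    omega
  refine (card_le_card h1).trans ((card_biUnion_le_card_mul _ _ k h2).trans (le_of_eq ?_))
  simp [sq]

end Counting

section Blowup

lemma injective_of_card_image {m n : ℕ} {f : Fin m → Fin n} (h : #(univ.image f) = m) :
    Function.Injective f := by
  have := card_image_iff.1 (show #(univ.image f) = #(univ : Finset (Fin m)) by simpa using h)
  rwa [coe_univ, Set.injOn_univ] at this

variable {N m n : ℕ}

/-- The hypergraph formed by a copy of `F` on each block of `M`. -/
def packedCopies (F : Finset (Finset (Fin m))) (β : Fin N → Fin m → Fin n) (M : Finset (Fin N)) :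
    Finset (Finset (Fin n)) :=
  M.biUnion fun b => F.image fun e => e.image (β b)

variable {F : Finset (Finset (Fin m))} {β : Fin N → Fin m → Fin n} {M : Finset (Fin N)}

lemma card_inter_blocks_le (hinj : ∀ b ∈ M, #(univ.image (β b)) = m) (hm : 2 ≤ m) {k : ℕ}
    (hk : 2 ≤ k)
    (hspan : ∀ J ⊆ M, 2 ≤ #J → #J ≤ k → (m - 2) * #J + 3 ≤ #(blockSpan β J)) {b b' : Fin N}
    (hb : b ∈ M) (hb' : b' ∈ M) (hne : b ≠ b') :
    #(univ.image (β b) ∩ univ.image (β b')) ≤ 1 := by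
  have h1 := hspan {b, b'} (by simp [insert_subset_iff, hb, hb']) (by rw [card_pair hne])
    (by rw [card_pair hne]; exact hk)
  have h2 := card_union_add_card_inter (univ.image (β b)) (univ.image (β b'))
  rw [hinj b hb, hinj b' hb'] at h2
  have h3 : blockSpan β {b, b'} = univ.image (β b) ∪ univ.image (β b') := by
    simp [blockSpan]
  rw [h3, card_pair hne] at h1
  omega

lemma eq_of_image_eq_image (hF : ∀ e ∈ F, #e = 3) (hinj : ∀ b ∈ M, #(univ.image (β b)) = m)
    (hm : 2 ≤ m) {k : ℕ} (hk : 2 ≤ k)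
    (hspan : ∀ J ⊆ M, 2 ≤ #J → #J ≤ k → (m - 2) * #J + 3 ≤ #(blockSpan β J)) {b b' : Fin N}
    (hb : b ∈ M) (hb' : b' ∈ M) {e e' : Finset (Fin m)} (he : e ∈ F)
    (heq : e.image (β b) = e'.image (β b')) : b = b' := by
  by_contra hne
  have h1 := card_inter_blocks_le hinj hm hk hspan hb hb' hne
  have hβ : Function.Injective (β b) :=
    injective_of_card_image (hinj b hb)
  have h2 : #(e.image (β b)) = 3 := by rw [card_image_of_injective _ hβ, hF e he]
  have h3 : e.image (β b) ⊆ univ.image (β b) ∩ univ.image (β b') := by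
    refine subset_inter (image_subset_image (subset_univ _)) ?_
    rw [heq]
    exact image_subset_image (subset_univ _)
  have := card_le_card h3
  omega

lemma card_of_mem_packedCopies (hF : ∀ e ∈ F, #e = 3) (hinj : ∀ b ∈ M, #(univ.image (β b)) = m) :
    ∀ e ∈ packedCopies F β M, #e = 3 := by
  intro e he
  simp only [packedCopies, mem_biUnion, mem_image] at he
  obtain ⟨b, hb, e, he, rfl⟩ := he
  rw [card_image_of_injective _ (injective_of_card_image (hinj b hb)), hF e he]

lemma card_biUnion_copies (hF : ∀ e ∈ F, #e = 3) (hinj : ∀ b ∈ M, #(univ.image (β b)) = m)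
    (hm : 2 ≤ m) {k : ℕ} (hk : 2 ≤ k)
    (hspan : ∀ J ⊆ M, 2 ≤ #J → #J ≤ k → (m - 2) * #J + 3 ≤ #(blockSpan β J))
    {T : Fin N → Finset (Finset (Fin m))} (hT : ∀ b ∈ M, T b ⊆ F) :
    #(M.biUnion fun b => (T b).image fun e => e.image (β b)) = ∑ b ∈ M, #(T b) := by
  rw [card_biUnion]
  · refine sum_congr rfl fun b hb => card_image_of_injective _ ?_
    exact Finset.image_injective (injective_of_card_image (hinj b hb))
  · intro b hb b' hb' hne
    rw [Function.onFun_apply, disjoint_left]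
    intro x hx hx'
    obtain ⟨e, he, rfl⟩ := mem_image.1 hx
    obtain ⟨e', he', heq⟩ := mem_image.1 hx'
    exact hne (eq_of_image_eq_image hF hinj hm hk hspan hb hb' (hT b hb he) heq.symm)

lemma isFree_packedCopies (hF : ∀ e ∈ F, #e = 3) (hinj : ∀ b ∈ M, #(univ.image (β b)) = m)
    (hm : 2 ≤ m) {k : ℕ} (hk : 2 ≤ k)
    (hspan : ∀ J ⊆ M, 2 ≤ #J → #J ≤ k → (m - 2) * #J + 3 ≤ #(blockSpan β J))
    (hfree : IsFree F (k + 2) k) (hsub : ∀ ℓ, 2 ≤ ℓ → ℓ ≤ k - 1 → IsFree F (ℓ + 1) ℓ) :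
    IsFree (packedCopies F β M) (k + 2) k := by
  rintro ⟨S, hS, hSk, hSspan⟩
  set T : Fin N → Finset (Finset (Fin m)) := fun b => F.filter fun e => e.image (β b) ∈ S with hTdef
  have hTF : ∀ b, T b ⊆ F := fun b => filter_subset _ _
  have hTS : ∀ b, ((T b).sup id).image (β b) ⊆ S.sup id := by
    intro b x hx
    obtain ⟨y, hy, rfl⟩ := mem_image.1 hx
    obtain ⟨e, he, hye⟩ := mem_sup.1 hy
    exact mem_sup.2 ⟨e.image (β b), (mem_filter.1 he).2, mem_image_of_mem _ hye⟩
  have hdecomp : S = M.biUnion fun b => (T b).image fun e => e.image (β b) := by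
    ext x
    simp only [mem_biUnion, mem_image, hTdef, mem_filter]
    constructor
    · intro hx
      have hx' := hS hx
      simp only [packedCopies, mem_biUnion, mem_image] at hx'
      obtain ⟨b, hb, e, he, rfl⟩ := hx'
      exact ⟨b, hb, e, ⟨he, hx⟩, rfl⟩
    · rintro ⟨b, hb, e, ⟨he, hx⟩, rfl⟩
      exact hx
  have hsum : ∑ b ∈ M, #(T b) = k := by
    rw [← hSk, ← card_biUnion_copies hF hinj hm hk hspan fun b _ => hTF b, ← hdecomp]
  set J := M.filter fun b => #(T b) ≠ 0 with hJ
  have hJM : J ⊆ M := filter_subset _ _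
  have hsumJ : ∑ b ∈ J, #(T b) = k := by
    rw [hJ, sum_filter_ne_zero, hsum]
  have hpos : ∀ b ∈ J, 1 ≤ #(T b) := fun b hb => Nat.one_le_iff_ne_zero.2 (mem_filter.1 hb).2
  have hJk : #J ≤ k := by
    calc #J = ∑ _b ∈ J, 1 := by simp
      _ ≤ ∑ b ∈ J, #(T b) := sum_le_sum hpos
      _ = k := hsumJ
  have hJ0 : J.Nonempty := by
    rw [nonempty_iff_ne_empty]
    intro h
    rw [h, sum_empty] at hsumJ
    omega
  obtain h1 | h2 : #J = 1 ∨ 2 ≤ #J := by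
    have := hJ0.card_pos
    omega
  · obtain ⟨b, hb⟩ := card_eq_one.1 h1
    rw [hb, sum_singleton] at hsumJ
    have hbM : b ∈ M := hJM (by rw [hb]; exact mem_singleton_self b)
    refine hfree ⟨T b, hTF b, hsumJ, ?_⟩
    rw [← card_image_of_injective _ (injective_of_card_image (hinj b hbM))]
    exact (card_le_card (hTS b)).trans hSspan
  · have hU : ∀ b ∈ J, #(T b) + 2 ≤ #((T b).sup id) := by
      intro b hb
      have hlt : #(T b) < k := by
        obtain ⟨b', hb', hne⟩ := exists_mem_ne h2 b
        have h3 : #(T b) + #(T b') ≤ k := by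
          rw [← sum_pair (f := fun b => #(T b)) hne.symm, ← hsumJ]
          exact sum_le_sum_of_subset (by simp [insert_subset_iff, hb, hb'])
        have := hpos b' hb'
        omega
      obtain h3 | h3 : #(T b) = 1 ∨ 2 ≤ #(T b) := by
        have := hpos b hb
        omega
      · obtain ⟨e, he⟩ := card_eq_one.1 h3
        have := hF e (hTF b (by rw [he]; exact mem_singleton_self e))
        rw [he, sup_singleton, card_singleton, id, this]
      · by_contra! h4
        exact hsub _ h3 (by omega) ⟨T b, hTF b, rfl, by omega⟩
    set W : Fin N → Finset (Fin n) := fun b =>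
      univ.image (β b) \ ((T b).sup id).image (β b) with hW
    have hWcard : ∀ b ∈ J, #(W b) + #(T b) + 2 ≤ m := by
      intro b hb
      have hbM := hJM hb
      have h3 : #(W b) + #(((T b).sup id).image (β b)) = #(univ.image (β b)) :=
        card_sdiff_add_card_eq_card (image_subset_image (subset_univ _))
      rw [hinj b hbM, card_image_of_injective _ (injective_of_card_image (hinj b hbM))] at h3
      have := hU b hb
      omega
    have hWsum : ∑ b ∈ J, #(W b) + k + 2 * #J ≤ m * #J := by
      have h3 := sum_le_sum hWcard
      simp only [sum_add_distrib, sum_const, smul_eq_mul, hsumJ] at h3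
      linarith
    have hcover : blockSpan β J ⊆ S.sup id ∪ J.biUnion W := by
      intro x hx
      obtain ⟨b, hb, hxb⟩ := mem_biUnion.1 hx
      by_cases hxT : x ∈ ((T b).sup id).image (β b)
      · exact mem_union_left _ (hTS b hxT)
      · exact mem_union_right _ (mem_biUnion.2 ⟨b, hb, mem_sdiff.2 ⟨hxb, hxT⟩⟩)
    have h3 := card_le_card hcover
    have h4 := card_union_le (S.sup id) (J.biUnion W)
    have h5 : #(J.biUnion W) ≤ ∑ b ∈ J, #(W b) := card_biUnion_le
    have h6 := hspan J hJM h2 hJk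
    obtain ⟨g, rfl⟩ : ∃ g, m = g + 2 := ⟨m - 2, by omega⟩
    rw [Nat.add_sub_cancel] at h6
    rw [add_mul] at hWsum
    omega

/-- A clean hypergraph on `m` vertices can be blown up to a dense one on any large vertex set. -/
lemma exists_le_exNum {m k : ℕ} (hm : 2 ≤ m) (hk : 2 ≤ k) {F : Finset (Finset (Fin m))}
    (hF : ∀ e ∈ F, #e = 3) (hfree : IsFree F (k + 2) k)
    (hsub : ∀ ℓ, 2 ≤ ℓ → ℓ ≤ k - 1 → IsFree F (ℓ + 1) ℓ) {ε : ℝ} (hε0 : 0 < ε) (hε1 : ε < 1) :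
    ∃ n₀ : ℕ, ∀ n, n₀ ≤ n →
      (1 - ε) ^ 2 * (n : ℝ) ^ 2 / (m : ℝ) ^ 2 * #F ≤ exNum 3 n (k + 2) k := by
  obtain ⟨n₀, hn₀⟩ := exists_packing hm k hε0 hε1
  refine ⟨n₀, fun n hn => ?_⟩
  obtain ⟨N, β, M, hinj, hspan, hM⟩ := hn₀ n hn
  have h1 := card_le_exNum (card_of_mem_packedCopies hF hinj)
    (isFree_packedCopies hF hinj hm hk hspan hfree hsub)
  have h2 : #(packedCopies F β M) = #M * #F := by
    rw [packedCopies, card_biUnion_copies hF hinj hm hk hspan fun b _ => subset_rfl, sum_const,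
      smul_eq_mul]
  rw [h2] at h1
  calc (1 - ε) ^ 2 * (n : ℝ) ^ 2 / (m : ℝ) ^ 2 * #F ≤ #M * #F := by gcongr
    _ ≤ exNum 3 n (k + 2) k := by exact_mod_cast h1

end Blowup

/-- If every sufficiently large `(k+2, k)`-free 3-graph can be made `(ℓ+1, ℓ)`-free for all
`2 ≤ ℓ ≤ k-1` by removing `o(m²)` edges, then `lim n⁻² f⁽³⁾(n; k+2, k)` exists. -/
theorem reduction_to_cleaning (k : ℕ) (hk : 3 ≤ k)
    (hclean : ∀ ε : ℝ, 0 < ε → ∃ m₀ : ℕ, ∀ m : ℕ, m₀ ≤ m →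
      ∀ F' : Finset (Finset (Fin m)), (∀ e ∈ F', e.card = 3) →
        IsFree F' (k + 2) k →
        ∃ F ⊆ F', (F'.card : ℝ) - ε * (m : ℝ) ^ 2 ≤ (F.card : ℝ) ∧
          ∀ ℓ, 2 ≤ ℓ → ℓ ≤ k - 1 → IsFree F (ℓ + 1) ℓ) :
    atTop.liminf (fun n : ℕ => (exNum 3 n (k + 2) k : ℝ) / (n : ℝ) ^ 2) =
      atTop.limsup (fun n : ℕ => (exNum 3 n (k + 2) k : ℝ) / (n : ℝ) ^ 2) := by
  set a : ℕ → ℝ := fun n => (exNum 3 n (k + 2) k : ℝ) / (n : ℝ) ^ 2 with ha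
  have ha0 : ∀ n, 0 ≤ a n := fun n => by positivity
  have hak : ∀ n, a n ≤ k := by
    intro n
    refine div_le_of_le_mul₀ (by positivity) (by positivity) ?_
    rw [mul_comm]
    exact_mod_cast exNum_le (n := n) (k := k) (by omega)
  have hbelow : IsBoundedUnder (· ≥ ·) atTop a := isBoundedUnder_of ⟨0, ha0⟩
  have habove : IsBoundedUnder (· ≤ ·) atTop a := isBoundedUnder_of ⟨k, hak⟩
  refine le_antisymm (liminf_le_limsup habove hbelow) ?_
  set L := limsup a atTop with hL
  have hLk : L ≤ k := limsup_le_of_le hbelow.isCoboundedUnder_le (Eventually.of_forall hak)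
  have key : ∀ ε : ℝ, 0 < ε → ε < 1 → L - (2 * k + 2) * ε ≤ liminf a atTop := by
    intro ε hε0 hε1
    obtain ⟨m₀, hm₀⟩ := hclean ε hε0
    have hfreq : ∃ᶠ m in atTop, L - ε < a m :=
      frequently_lt_of_lt_limsup hbelow.isCoboundedUnder_le (by linarith)
    obtain ⟨m, hmm, ham⟩ := frequently_atTop.1 hfreq (max m₀ 2)
    have hm2 : 2 ≤ m := (le_max_right _ _).trans hmm
    have hmpos : (0 : ℝ) < (m : ℝ) ^ 2 := by positivity
    obtain ⟨F', hF', hfree', hcard'⟩ := exists_card_eq_exNum 3 m (k + 2) (by omega : 0 < k)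
    obtain ⟨F, hFF', hcard, hsub⟩ := hm₀ m ((le_max_left _ _).trans hmm) F' hF' hfree'
    have hfree : IsFree F (k + 2) k := fun ⟨S, hS, h⟩ => hfree' ⟨S, hS.trans hFF', h⟩
    have hFL : L - 2 * ε ≤ #F / (m : ℝ) ^ 2 := by
      rw [le_div_iff₀ hmpos]
      rw [ha, lt_div_iff₀ hmpos, ← hcard'] at ham
      linarith
    obtain ⟨n₀, hn₀⟩ := exists_le_exNum hm2 (by omega) (fun e he => hF' e (hFF' he)) hfree hsub
      hε0 hε1
    refine le_liminf_of_le habove.isCoboundedUnder_ge ?_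
    filter_upwards [eventually_ge_atTop n₀, eventually_ge_atTop 1] with n hn hn1
    have hnpos : (0 : ℝ) < (n : ℝ) ^ 2 := by positivity
    have h1 : (1 - ε) ^ 2 * (#F / (m : ℝ) ^ 2) ≤ a n := by
      rw [ha, le_div_iff₀ hnpos]
      refine le_trans (le_of_eq ?_) (hn₀ n hn)
      ring
    have h2 := mul_le_mul_of_nonneg_left hFL (sq_nonneg (1 - ε))
    have h3 : (1 - ε) ^ 2 ≤ 1 := by nlinarith
    have h4 : 0 ≤ (k - L) * ε := mul_nonneg (by linarith) hε0.le
    have h5 : (0 : ℝ) ≤ (1 - (1 - ε) ^ 2) * (2 * ε) := mul_nonneg (by linarith) (by linarith)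
    have h6 : 0 ≤ (1 - (1 - ε) ^ 2) * (k - L) := mul_nonneg (by linarith) (by linarith)
    have h7 : 0 ≤ (k : ℝ) * ε ^ 2 := by positivity
    nlinarith
  refine le_of_forall_pos_sub_le fun δ hδ => ?_
  have hc : (0 : ℝ) < 2 * k + 2 := by positivity
  have h1 := key (min (1 / 2) (δ / (2 * k + 2))) (lt_min (by norm_num) (by positivity))
    ((min_le_left _ _).trans_lt (by norm_num))
  have h2 : (2 * k + 2) * min (1 / 2) (δ / (2 * k + 2)) ≤ δ := by
    calc (2 * k + 2) * min (1 / 2) (δ / (2 * k + 2)) ≤ (2 * k + 2) * (δ / (2 * k + 2)) := by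
          gcongr
          exact min_le_right _ _
      _ = δ := by field_simp
  linarith
end

section
/- There exists a 3-graph T on 9 vertices with exactly 7 edges which is (6,4)-free and (4,3)-free, whose 2-shadow has exactly 18 edges, and such that the non-edge girth of the pair (T, J) is at least 3, where J is the 2-shadow of T. (An explicit example is the 3-graph T₇ with vertex set {x₁,x₂,x₃,a₁,b₁,a₂,b₂,a₃,b₃} and edges x₁x₂x₃, a₁b₁x₂, a₁b₁x₃, a₂b₂x₁, a₂b₂x₃, a₃b₃x₁, a₃b₃x₂.) -/
open Finset Filter

/-- The edges of the 3-graph `T₇`: a central edge `{0, 1, 2}` and, over each pair of its vertices,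
two edges sharing a pair of new vertices. -/
def edgeT7 : Fin 7 → Finset (Fin 9) :=
  ![{0, 1, 2}, {3, 4, 1}, {3, 4, 2}, {5, 6, 0}, {5, 6, 2}, {7, 8, 0}, {7, 8, 1}]

/-- The edge set of the 3-graph `T₇`. -/
def edgesT7 : Finset (Finset (Fin 9)) := univ.image edgeT7

lemma isFree_image_of_strictMono {V : Type*} [DecidableEq V] {n s k : ℕ} {e : Fin n → Finset V}
    (h : ∀ f : Fin k → Fin n, StrictMono f → s < (univ.sup fun i => e (f i)).card) :
    IsFree (univ.image e) s k := by
  rintro ⟨S, hS, hk, hs⟩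
  obtain ⟨I, -, rfl⟩ := subset_image_iff.1 hS
  have hI : k ≤ I.card := hk ▸ card_image_le
  refine ((h _ (I.orderEmbOfCardLe hI).strictMono).trans_le (card_le_card ?_)).not_ge hs
  exact Finset.sup_le fun i _ =>
    le_sup (f := id) (mem_image_of_mem e (I.orderEmbOfCardLe_mem hI i))

lemma four_lt_card_union_edgeT7 : ∀ i j, i < j → ∀ k, j < k →
    4 < (edgeT7 i ∪ (edgeT7 j ∪ edgeT7 k)).card := by
  decide +kernel

lemma six_lt_card_union_edgeT7 : ∀ i j, i < j → ∀ k, j < k → ∀ l, k < l →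
    6 < (edgeT7 i ∪ (edgeT7 j ∪ (edgeT7 k ∪ edgeT7 l))).card := by
  decide +kernel

lemma isFree_edgesT7_four_three : IsFree edgesT7 4 3 := by
  refine isFree_image_of_strictMono fun f hf => ?_
  refine (four_lt_card_union_edgeT7 (f 0) (f 1) (hf (by decide)) (f 2) (hf (by decide))).trans_le
    (card_le_card ?_)
  simp only [union_subset_iff]
  refine ⟨?_, ?_, ?_⟩ <;> exact le_sup (f := fun i => edgeT7 (f i)) (mem_univ _)

lemma isFree_edgesT7_six_four : IsFree edgesT7 6 4 := by
  refine isFree_image_of_strictMono fun f hf => ?_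
  refine (six_lt_card_union_edgeT7 (f 0) (f 1) (hf (by decide)) (f 2) (hf (by decide)) (f 3)
    (hf (by decide))).trans_le (card_le_card ?_)
  simp only [union_subset_iff]
  refine ⟨?_, ?_, ?_, ?_⟩ <;> exact le_sup (f := fun i => edgeT7 (f i)) (mem_univ _)

lemma card_shadow_edgesT7 : (edgesT7.sup fun e => e.powersetCard 2).card = 18 := by
  decide +kernel

lemma powersetCard_two_union_subset_shadow_edgesT7 : ∀ e ∈ edgesT7, ∀ f ∈ edgesT7,
    (e ∪ f).card ≤ 4 → (e ∪ f).powersetCard 2 ⊆ edgesT7.sup fun e => e.powersetCard 2 := by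
  decide +kernel

/-- There is a 3-graph on 9 vertices with 7 edges which is (6,4)-free and (4,3)-free, whose
2-shadow has 18 edges, and whose non-edge girth (with respect to its 2-shadow) is at least 3,
i.e. for `g ∈ {1,2}` no `(g+2, g)`-configuration contains a non-edge of the shadow. -/
theorem exists_T7 : ∃ T : Finset (Finset (Fin 9)),
    (∀ e ∈ T, e.card = 3) ∧ T.card = 7 ∧ T.sup id = Finset.univ ∧
    IsFree T 6 4 ∧ IsFree T 4 3 ∧
    (T.sup fun e => e.powersetCard 2).card = 18 ∧
    (∀ g, 1 ≤ g → g ≤ 2 →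
      ¬ ∃ S ⊆ T, S.card = g ∧ (S.sup id).card ≤ g * 1 + 2 ∧
        ∃ P ⊆ S.sup id, P.card = 2 ∧ P ∉ T.sup fun e => e.powersetCard 2) := by
  refine ⟨edgesT7, by decide +kernel, by decide +kernel, by decide +kernel,
    isFree_edgesT7_six_four, isFree_edgesT7_four_three, card_shadow_edgesT7, ?_⟩
  rintro g h1 h2 ⟨S, hS, hg, hs, P, hP, hP2, hPT⟩
  interval_cases g
  · obtain ⟨e, rfl⟩ := card_eq_one.1 hg
    exact hPT (mem_sup.2 ⟨e, hS (by simp), mem_powersetCard.2 ⟨by simpa using hP, hP2⟩⟩)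
  · obtain ⟨e, f, -, rfl⟩ := card_eq_two.1 hg
    simp only [sup_insert, sup_singleton, id_eq, sup_eq_union] at hs hP
    exact hPT (powersetCard_two_union_subset_shadow_edgesT7 e (hS (by simp)) f (hS (by simp)) hs
      (mem_powersetCard.2 ⟨hP, hP2⟩))
end
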